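/- Let d ≥ 2, k ≥ 3, and let E ⊆ ℝ^d be a compact set with dim(E) > ((k−1)d + 1)/k. Then the k-point diagonal configuration set Δ°_k^diag(E) has non-empty interior in ℝ. -/

import Mathlib

open MeasureTheory
open scoped ENNReal

lemma exists_equilibrium {X : Type*} [Fintype X] [Nonempty X] (K : X → X → ℝ)
    (hK : ∀ x y, K x y = K y x) :
    ∃ (p : X → ℝ) (Q : ℝ), (∀ x, 0 ≤ p x) ∧ ∑ x, p x = 1 ∧
      (∀ x, Q ≤ ∑ y, K x y * p y) ∧ (∀ x, p x ≠ 0 → ∑ y, K x y * p y = Q) := by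
  classical
  let F : (X → ℝ) → ℝ := fun p => ∑ x, p x * ∑ y, K x y * p y
  have hFc : Continuous F := by fun_prop
  obtain ⟨p, hp, hmin⟩ := (isCompact_stdSimplex (𝕜 := ℝ) X).exists_isMinOn
    ⟨_, single_mem_stdSimplex ℝ (Classical.arbitrary X)⟩ hFc.continuousOn
  have hU : ∀ x, F p ≤ ∑ y, K x y * p y := by
    intro x
    by_contra! hlt
    set U := ∑ y, K x y * p y with hUdef
    have key : ∀ t : ℝ, F ((1 - t) • p + t • Pi.single x 1) =
        (1 - t)^2 * F p + 2 * t * (1 - t) * U + t^2 * K x x := by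
      intro t
      have h1 : ∀ z, ∑ y, K z y * ((1 - t) • p + t • (Pi.single x 1 : X → ℝ)) y
          = (1 - t) * ∑ y, K z y * p y + t * K z x := by
        intro z
        simp only [Pi.add_apply, Pi.smul_apply, smul_eq_mul, mul_add, Finset.sum_add_distrib]
        congr 1
        · rw [Finset.mul_sum]; exact Finset.sum_congr rfl fun y _ => by ring
        · simp [Pi.single_apply, mul_comm]
      have h3 : ∑ z, p z * K z x = U := by
        rw [hUdef]; exact Finset.sum_congr rfl fun y _ => by rw [hK y x]; ring
      have h2 : F ((1 - t) • p + t • Pi.single x 1) =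
          (1 - t) * ((1 - t) * F p + t * ∑ z, p z * K z x)
            + t * ((1 - t) * U + t * K x x) := by
        simp only [F]
        simp only [h1]
        have : ∀ z, ((1 - t) • p + t • (Pi.single x 1 : X → ℝ)) z *
            ((1 - t) * ∑ y, K z y * p y + t * K z x) =
            (1 - t) * ((1-t) * (p z * ∑ y, K z y * p y) + t * (p z * K z x)) +
            (if z = x then t * ((1 - t) * ∑ y, K z y * p y + t * K z x) else 0) := by
          intro z
          by_cases hz : z = x
          · subst hz; simp; ring
          · simp [hz]; ring
        simp only [this, Finset.sum_add_distrib, ← Finset.mul_sum]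
        simp [hUdef]
      rw [h2, h3]; ring
    have hmem : ∀ t : ℝ, 0 ≤ t → t ≤ 1 → F p ≤ (1 - t)^2 * F p + 2 * t * (1 - t) * U + t^2 * K x x := by
      intro t h0 h1
      rw [← key t]
      apply hmin
      exact (convex_stdSimplex ℝ X) hp (single_mem_stdSimplex ℝ x) (by linarith) h0 (by ring)
    set D := F p - U with hD
    have hDpos : 0 < D := by linarith
    set A := |F p - 2 * U + K x x| + D with hA
    have hApos : D ≤ A := by have := abs_nonneg (F p - 2 * U + K x x); linarith
    have ht := hmem (D / A) (by positivity) (by rw [div_le_one (by linarith)]; exact hApos)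
    have e : (1 - D/A)^2 * F p + 2 * (D/A) * (1 - D/A) * U + (D/A)^2 * K x x - F p =
      (D/A) * (-2 * D + (D/A) * (F p - 2 * U + K x x)) := by rw [hD]; ring
    have hpos : 0 < D / A := by apply div_pos hDpos; linarith
    have h4 : 0 ≤ -2 * D + (D/A) * (F p - 2 * U + K x x) := by
      by_contra! hneg
      have := mul_neg_of_pos_of_neg hpos hneg
      linarith
    have h5 : (D/A) * (F p - 2 * U + K x x) ≤ (D/A) * A := by
      apply mul_le_mul_of_nonneg_left _ hpos.le
      have := le_abs_self (F p - 2 * U + K x x); linarith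
    rw [div_mul_cancel₀ _ (by linarith : A ≠ 0)] at h5
    linarith
  refine ⟨p, F p, hp.1, hp.2, hU, ?_⟩
  have hs : ∑ x, p x * (∑ y, K x y * p y - F p) = 0 := by
    simp only [mul_sub, Finset.sum_sub_distrib, ← Finset.sum_mul, hp.2]
    simp [F]
  rw [Finset.sum_eq_zero_iff_of_nonneg (fun x _ => mul_nonneg (hp.1 x) (by linarith [hU x]))] at hs
  intro x hx
  have := hs x (Finset.mem_univ x)
  rcases mul_eq_zero.1 this with h | h
  · exact absurd h hx
  · linarith

lemma finite_cover {V X : Type*} [MetricSpace V] [Fintype X] (e : X → V) (p : X → ℝ)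
    (hp : ∀ x, 0 ≤ p x) (hp1 : ∑ x, p x = 1) (δ M s' : ℝ)
    (r : X → ℝ) (hr0 : ∀ x, δ ≤ r x) (hr1 : ∀ x, r x ≤ 1) 
    (hm : ∀ x, M * (r x) ^ s' ≤ ∑ y, if dist (e y) (e x) ≤ r x then p y else 0)
    (E : Set V) (hE : E ⊆ ⋃ x, Metric.closedBall (e x) δ) :
    ∃ u : Finset X, E ⊆ (⋃ x : u, Metric.closedBall (e x) (5 * r x)) ∧
      ∑ x ∈ u, M * (r x) ^ s' ≤ 1 := by
  classical
  obtain ⟨u, -, hdis, hcov⟩ := Vitali.exists_disjoint_subfamily_covering_enlargement_closedBall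
    (Set.univ : Set X) e r 1 (fun a _ => hr1 a) 5 (by norm_num)
  refine ⟨u.toFinset, ?_, ?_⟩
  · intro z hz
    obtain ⟨x, hx⟩ := Set.mem_iUnion.1 (hE hz)
    obtain ⟨b, hb, hsub⟩ := hcov x (Set.mem_univ x)
    refine Set.mem_iUnion.2 ⟨⟨b, by simpa using hb⟩, hsub ?_⟩
    exact Metric.closedBall_subset_closedBall (hr0 x) hx
  · calc ∑ x ∈ u.toFinset, M * (r x) ^ s' 
        ≤ ∑ x ∈ u.toFinset, ∑ y, if dist (e y) (e x) ≤ r x then p y else 0 :=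
          Finset.sum_le_sum fun x _ => hm x
      _ = ∑ y, ∑ x ∈ u.toFinset, if dist (e y) (e x) ≤ r x then p y else 0 := Finset.sum_comm
      _ ≤ ∑ y, p y := by
          apply Finset.sum_le_sum
          intro y _
          by_cases h : ∃ x ∈ u, dist (e y) (e x) ≤ r x
          · obtain ⟨x, hx, hxy⟩ := h
            rw [Finset.sum_eq_single x]
            · simp [hxy]
            · intro b hb hbx
              rw [if_neg]
              intro hby
              exact Set.disjoint_left.1 (hdis (by simpa using hb) hx hbx) 
                (Metric.mem_closedBall.2 hby) (Metric.mem_closedBall.2 hxy)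
            · intro h; exact absurd (by simpa using hx) h
          · push Not at h
            rw [Finset.sum_eq_zero]
            · exact hp y
            · intro x hx
              rw [if_neg]
              exact not_le.2 (h x (by simpa using hx))
      _ = 1 := hp1


lemma layer_bound (s : ℝ) (hs : 0 < s) (N : ℕ) (r : ℝ) :
    (max r ((1/2 : ℝ)^N)) ^ (-s) ≤ 1 + ∑ n ∈ Finset.range (N+1),
      ((2:ℝ)^s)^(n+1) * (if r ≤ (1/2 : ℝ)^n then 1 else 0) := by
  have hnn : ∀ n ∈ Finset.range (N+1), 0 ≤ 
      ((2:ℝ)^s)^(n+1) * (if r ≤ (1/2 : ℝ)^n then (1:ℝ) else 0) := by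
    intro n _; split_ifs <;> positivity
  have hpow : ∀ n : ℕ, ((1/2:ℝ)^n)^(-s) = ((2:ℝ)^s)^n := by
    intro n
    rw [← Real.rpow_natCast, ← Real.rpow_natCast, ← Real.rpow_mul (by norm_num),
      ← Real.rpow_mul (by norm_num), one_div, Real.inv_rpow (by norm_num), 
      ← Real.rpow_neg (by norm_num)]
    congr 1; ring
  have h2s : (1:ℝ) ≤ 2^s := Real.one_le_rpow (by norm_num) hs.le
  by_cases hr : 1 < r
  · have : (max r ((1/2 : ℝ)^N)) ^ (-s) ≤ 1 := by
      apply Real.rpow_le_one_of_one_le_of_nonpos _ (by linarith)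
      exact hr.le.trans (le_max_left _ _)
    linarith [Finset.sum_nonneg hnn]
  push Not at hr
  -- choose n maximal
  classical
  let n := Nat.findGreatest (fun n => r ≤ (1/2:ℝ)^n) N
  have hn : r ≤ (1/2:ℝ)^n := 
    Nat.findGreatest_spec (P := fun n => r ≤ (1/2:ℝ)^n) (Nat.zero_le N) (by simpa using hr)
  have hnN : n ≤ N := Nat.findGreatest_le N
  have hle : (max r ((1/2 : ℝ)^N)) ^ (-s) ≤ ((2:ℝ)^s)^(n+1) := by
    rcases hnN.eq_or_lt with h | h
    · calc (max r ((1/2 : ℝ)^N)) ^ (-s) ≤ ((1/2:ℝ)^N)^(-s) := 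
          Real.rpow_le_rpow_of_nonpos (by positivity) (le_max_right _ _) (by linarith)
        _ = ((2:ℝ)^s)^N := hpow N
        _ ≤ _ := by rw [h]; exact pow_le_pow_right₀ h2s (Nat.le_succ N)
    · have : ¬ r ≤ (1/2:ℝ)^(n+1) := 
        Nat.findGreatest_is_greatest (P := fun n => r ≤ (1/2:ℝ)^n) (Nat.lt_succ_self n) h
      push Not at this
      rw [← hpow]
      exact Real.rpow_le_rpow_of_nonpos (by positivity) (this.le.trans (le_max_left _ _)) (by linarith)
  have := Finset.single_le_sum hnn (Finset.mem_range.2 (Nat.lt_succ_of_le hnN))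
  rw [if_pos hn, mul_one] at this
  linarith

lemma exists_scale {V X : Type*} [MetricSpace V] [Fintype X] (e : X → V) (p : X → ℝ)
    (hp : ∀ x, 0 ≤ p x) (hp1 : ∑ x, p x = 1) (N : ℕ) (s ε M Q : ℝ) (hs : 0 < s) (hε : 0 < ε)
    (hM : 0 < M) (hQ : 1 + M * (2^s / (1 - (1/2)^ε)) ≤ Q) (x : X)
    (hU : Q ≤ ∑ y, (max (dist (e x) (e y)) ((1/2 : ℝ)^N)) ^ (-s) * p y) :
    ∃ n ≤ N, M * ((1/2 : ℝ)^n) ^ (s + ε) ≤ 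
      ∑ y, if dist (e y) (e x) ≤ (1/2 : ℝ)^n then p y else 0 := by
  by_contra! hcon
  have hq0 : (0:ℝ) < (1/2)^ε := by positivity
  have hq1 : ((1/2:ℝ))^ε < 1 := Real.rpow_lt_one (by norm_num) (by norm_num) hε
  have h1 : ∑ y, (max (dist (e x) (e y)) ((1/2 : ℝ)^N)) ^ (-s) * p y ≤
      1 + ∑ n ∈ Finset.range (N+1), ((2:ℝ)^s)^(n+1) * 
        ∑ y, if dist (e y) (e x) ≤ (1/2 : ℝ)^n then p y else 0 := by
    calc _ ≤ ∑ y, (1 + ∑ n ∈ Finset.range (N+1),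
      ((2:ℝ)^s)^(n+1) * (if dist (e x) (e y) ≤ (1/2 : ℝ)^n then 1 else 0)) * p y := by
          apply Finset.sum_le_sum
          intro y _
          exact mul_le_mul_of_nonneg_right (layer_bound s hs N _) (hp y)
      _ = _ := by
          simp only [add_mul, one_mul, Finset.sum_add_distrib, hp1, Finset.sum_mul]
          rw [Finset.sum_comm]
          simp only [Finset.mul_sum]
          congr 1
          refine Finset.sum_congr rfl fun n _ => Finset.sum_congr rfl fun y _ => ?_
          rw [dist_comm (e x) (e y)]
          split_ifs <;> ring
  have h2 : ∑ n ∈ Finset.range (N+1), ((2:ℝ)^s)^(n+1) * 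
        (∑ y, if dist (e y) (e x) ≤ (1/2 : ℝ)^n then p y else 0) < 
        ∑ n ∈ Finset.range (N+1), M * 2^s * ((1/2:ℝ)^ε)^n := by
    apply Finset.sum_lt_sum_of_nonempty ⟨0, by simp⟩
    intro n hn
    have := hcon n (by simpa [Nat.lt_succ_iff] using hn)
    have h3 : M * 2^s * ((1/2:ℝ)^ε)^n = ((2:ℝ)^s)^(n+1) * (M * ((1/2 : ℝ)^n) ^ (s + ε)) := by
      rw [Real.rpow_add (by positivity), ← Real.rpow_natCast (1/2) n, ← Real.rpow_mul (by norm_num),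
        ← Real.rpow_mul (by norm_num), mul_comm (n:ℝ) s, mul_comm (n:ℝ) ε, 
        Real.rpow_mul (by norm_num), Real.rpow_mul (by norm_num) ε, Real.rpow_natCast, 
        Real.rpow_natCast, pow_succ]
      have : ((2:ℝ)^s)^n * ((1/2:ℝ)^s)^n = 1 := by
        rw [← mul_pow, ← Real.mul_rpow (by norm_num) (by norm_num)]; norm_num
      linear_combination (- M * 2^s * ((1/2:ℝ)^ε)^n) * this
    rw [h3]
    exact mul_lt_mul_of_pos_left this (by positivity)
  have h4 : ∑ n ∈ Finset.range (N+1), M * 2^s * ((1/2:ℝ)^ε)^n ≤ M * (2^s / (1 - (1/2)^ε)) := by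
    rw [← Finset.mul_sum, mul_assoc, div_eq_mul_inv (2^s)]
    refine mul_le_mul_of_nonneg_left (mul_le_mul_of_nonneg_left ?_ (by positivity)) hM.le
    rw [← tsum_geometric_of_lt_one hq0.le hq1]
    exact (summable_geometric_of_lt_one hq0.le hq1).sum_le_tsum _ (fun _ _ => by positivity)
  linarith

lemma discrete_frostman {V : Type*} [MetricSpace V] [MeasurableSpace V] [BorelSpace V]
    (E : Set V) (hE : IsCompact E) (s ε : ℝ) (hs : 0 < s) (hε : 0 < ε)
    (hH : μH[s + ε] E ≠ 0) :
    ∃ C : ℝ, ∀ N : ℕ, ∃ (X : Finset V) (p : X → ℝ), (X : Set V) ⊆ E ∧ (∀ x, 0 ≤ p x) ∧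
      ∑ x, p x = 1 ∧ ∀ x, p x ≠ 0 → 
        ∑ y : X, (max (dist (x:V) (y:V)) ((1/2 : ℝ)^N)) ^ (-s) * p y ≤ C := by
  classical
  have hne : E.Nonempty := by
    rw [Set.nonempty_iff_ne_empty]; rintro rfl; simp at hH
  have hex : ∀ N : ℕ, ∃ (X : Finset V) (p : X → ℝ) (Q : ℝ), (X : Set V) ⊆ E ∧ 
      (E ⊆ ⋃ x : X, Metric.closedBall (x:V) ((1/2:ℝ)^N)) ∧ (∀ x, 0 ≤ p x) ∧
      ∑ x, p x = 1 ∧ (∀ x : X, Q ≤ ∑ y : X, (max (dist (x:V) (y:V)) ((1/2 : ℝ)^N)) ^ (-s) * p y) ∧ 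
      ∀ x, p x ≠ 0 → ∑ y : X, (max (dist (x:V) (y:V)) ((1/2 : ℝ)^N)) ^ (-s) * p y = Q := by
    intro N
    obtain ⟨t, htE, htf, htc⟩ := hE.finite_cover_balls (show (0:ℝ) < (1/2)^N by positivity)
    lift t to Finset V using htf
    have hcov : E ⊆ ⋃ x : t, Metric.closedBall (x:V) ((1/2:ℝ)^N) := by
      intro z hz
      obtain ⟨x, hx, hzx⟩ := Set.mem_iUnion₂.1 (htc hz)
      exact Set.mem_iUnion.2 ⟨⟨x, hx⟩, Metric.ball_subset_closedBall hzx⟩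
    have : Nonempty t := by
      obtain ⟨z, hz⟩ := hne
      obtain ⟨x, -⟩ := Set.mem_iUnion.1 (hcov hz)
      exact ⟨x⟩
    obtain ⟨p, Q, h1, h2, h3, h4⟩ := exists_equilibrium 
      (fun x y : t => (max (dist (x:V) (y:V)) ((1/2 : ℝ)^N)) ^ (-s)) 
      (fun x y => by simp only [dist_comm])
    exact ⟨t, p, Q, htE, hcov, h1, h2, h3, h4⟩
  choose X p Q hXE hcov hp0 hp1 hU hUeq using hex
  suffices h : ∃ C, ∀ N, Q N ≤ C by
    obtain ⟨C, hC⟩ := h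
    exact ⟨C, fun N => ⟨X N, p N, hXE N, hp0 N, hp1 N, fun x hx => (hUeq N x hx).trans_le (hC N)⟩⟩
  by_contra! hcon
  apply hH
  choose Nm hNm using fun m : ℕ => hcon (1 + ((m:ℝ)+1) * (2^s / (1 - (1/2)^ε)))
  have hsc : ∀ m : ℕ, ∀ x : X (Nm m), ∃ n ≤ Nm m, ((m:ℝ)+1) * ((1/2 : ℝ)^n) ^ (s + ε) ≤ 
      ∑ y : X (Nm m), if dist (y:V) (x:V) ≤ (1/2 : ℝ)^n then p (Nm m) y else 0 := fun m x =>
    exists_scale (fun x : X (Nm m) => (x : V)) (p (Nm m)) (hp0 _) (hp1 _) (Nm m) s ε (m+1) 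
      (Q (Nm m)) hs hε (by positivity) (hNm m).le x (hU _ x)
  choose n hn hmass using hsc
  have hfc := fun m : ℕ => finite_cover (fun x : X (Nm m) => (x : V)) (p (Nm m)) (hp0 _) (hp1 _) 
    ((1/2)^(Nm m)) (m+1) (s+ε) (fun x => (1/2)^(n m x)) 
    (fun x => pow_le_pow_of_le_one (by norm_num) (by norm_num) (hn m x))
    (fun x => pow_le_one₀ (by norm_num) (by norm_num)) (hmass m) E (hcov (Nm m))
  choose u hucov husum using hfc
  set s' := s + ε with hs'
  have hs'0 : 0 < s' := by linarith
  have hone : ∀ m, ∀ x ∈ u m, ((1/2:ℝ)^(n m x))^s' ≤ 1 / ((m:ℝ)+1) := by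
    intro m x hx
    rw [le_div_iff₀ (by positivity), mul_comm]
    exact (Finset.single_le_sum (f := fun x => ((m:ℝ)+1) * ((1/2:ℝ)^(n m x))^s') 
      (fun i _ => by positivity) hx).trans (husum m)
  have hdiam : ∀ m (x : X (Nm m)), Metric.ediam (Metric.closedBall (x:V) (5 * (1/2:ℝ)^(n m x))) ≤ 
      ENNReal.ofReal (10 * (1/2:ℝ)^(n m x)) := by
    intro m x
    refine Metric.ediam_le_of_forall_dist_le fun y hy z hz => ?_
    have h1 := Metric.mem_closedBall.1 hy
    have h2 := Metric.mem_closedBall.1 hz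
    have := dist_triangle_right y z (x:V)
    linarith
  have hlim0 : Filter.Tendsto (fun m : ℕ => 1 / ((m:ℝ)+1)) Filter.atTop (nhds 0) := 
    tendsto_one_div_add_atTop_nhds_zero_nat
  have hH0 := Measure.hausdorffMeasure_le_liminf_sum (β := ℕ) (ι := fun m => u m) s' E 
    (l := Filter.atTop) 
    (fun m => ENNReal.ofReal (10 * (1 / ((m:ℝ)+1)) ^ (1/s'))) ?_
    (fun m x => Metric.closedBall ((x : X (Nm m)) : V) (5 * (1/2:ℝ)^(n m x))) ?_ ?_
  · refine le_antisymm (hH0.trans ?_) (by simp)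
    have hb : ∀ m : ℕ, ∑ x : u m, Metric.ediam (Metric.closedBall ((x : X (Nm m)) : V) 
        (5 * (1/2:ℝ)^(n m x))) ^ s' ≤ ENNReal.ofReal (10^s' * (1 / ((m:ℝ)+1))) := by
      intro m
      calc _ ≤ ∑ x : u m, ENNReal.ofReal (10^s' * ((1/2:ℝ)^(n m x))^s') := by
            apply Finset.sum_le_sum
            intro x _
            rw [← Real.mul_rpow (by norm_num) (by positivity), 
              ← ENNReal.ofReal_rpow_of_nonneg (by positivity) hs'0.le]
            exact ENNReal.rpow_le_rpow (hdiam m x) hs'0.le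
        _ = ENNReal.ofReal (∑ x : u m, (10^s' * ((1/2:ℝ)^(n m x))^s')) := by
            rw [ENNReal.ofReal_sum_of_nonneg]; intro i _; positivity
        _ ≤ _ := by
            apply ENNReal.ofReal_le_ofReal
            rw [← Finset.mul_sum]
            gcongr
            rw [le_div_iff₀ (by positivity), mul_comm, Finset.mul_sum, 
              Finset.sum_coe_sort (u m) (fun x => ((m:ℝ)+1) * ((1/2:ℝ)^(n m x))^s')]
            exact husum m
    have ht : Filter.Tendsto (fun m : ℕ => ENNReal.ofReal (10^s' * (1 / ((m:ℝ)+1)))) 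
        Filter.atTop (nhds 0) := by
      rw [← ENNReal.ofReal_zero]
      apply ENNReal.tendsto_ofReal
      simpa using hlim0.const_mul ((10:ℝ)^s')
    rw [← ht.liminf_eq]
    exact Filter.liminf_le_liminf (Filter.Eventually.of_forall hb)
  · rw [← ENNReal.ofReal_zero]
    apply ENNReal.tendsto_ofReal
    have := (hlim0.rpow_const (p := 1/s') (Or.inr (by positivity))).const_mul 10
    rwa [Real.zero_rpow (by positivity), mul_zero] at this
  · refine Filter.Eventually.of_forall fun m x => (hdiam m x).trans ?_
    apply ENNReal.ofReal_le_ofReal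
    gcongr
    rw [one_div s', Real.le_rpow_inv_iff_of_pos (by positivity) (by positivity) hs'0]
    exact hone m x x.2
  · exact Filter.Eventually.of_forall fun m => hucov m


lemma exp_neg_le_rpow (t u : ℝ) (ht : 0 < t) (hu : 0 < u) :
    Real.exp (-u) ≤ t ^ t * u ^ (-t) := by
  have h1 : u / t ≤ Real.exp (u / t) := by linarith [Real.add_one_le_exp (u / t)]
  have h2 : (u / t) ^ t ≤ Real.exp u := by
    calc (u/t)^t ≤ (Real.exp (u/t))^t := Real.rpow_le_rpow (by positivity) h1 ht.le
      _ = Real.exp u := by rw [← Real.exp_mul]; congr 1; field_simp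
  rw [Real.exp_neg, Real.rpow_neg hu.le]
  rw [Real.div_rpow hu.le ht.le] at h2
  have h3 : 0 < t^t := by positivity
  have h4 : 0 < u^t := by positivity
  rw [div_le_iff₀ h3] at h2
  rw [← div_eq_mul_inv, inv_eq_one_div, div_le_div_iff₀ (Real.exp_pos u) h4]
  linarith

lemma gauss_le_kernel (s a r δ : ℝ) (hs : 0 < s) (ha : 0 < a) (hδ : 0 < δ)
    (haδ : a * δ ^ 2 ≤ 1) :
    Real.exp (-(a * r ^ 2)) ≤ (1 + (s/2)^(s/2)) * a ^ (-(s/2)) * (max r δ) ^ (-s) := by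
  have hm : 0 < max r δ := lt_max_of_lt_right hδ
  have e1 : (a * (max r δ)^2) ^ (-(s/2)) = a ^ (-(s/2)) * (max r δ) ^ (-s) := by
    rw [Real.mul_rpow ha.le (by positivity), ← Real.rpow_natCast (max r δ) 2, ← Real.rpow_mul hm.le]
    congr 2; push_cast; ring
  rw [mul_assoc, ← e1]
  have h0 : 0 < (s/2)^(s/2) := by positivity
  rcases le_total r δ with h | h
  · rw [max_eq_right h]
    have h1 : 1 ≤ (a * δ^2) ^ (-(s/2)) := 
      Real.one_le_rpow_of_pos_of_le_one_of_nonpos (by positivity) haδ (by linarith)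
    have h2 : Real.exp (-(a * r^2)) ≤ 1 := Real.exp_le_one_iff.2 (by
      have : 0 ≤ a * r^2 := by positivity
      linarith)
    nlinarith
  · rw [max_eq_left h]
    have hr' : 0 < r := by linarith
    have := exp_neg_le_rpow (s/2) (a * r^2) (by positivity) (by positivity)
    have h3 : 0 < (a * r^2) ^ (-(s/2)) := by positivity
    linarith

lemma discrete_gauss {V : Type*} [MetricSpace V] (X : Finset V) (p : X → ℝ) 
    (hp0 : ∀ x, 0 ≤ p x) (hp1 : ∑ x, p x = 1) (s C δ : ℝ) (hs : 0 < s) (hδ : 0 < δ)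
    (hC : ∀ x, p x ≠ 0 → ∑ y : X, (max (dist (x:V) (y:V)) δ) ^ (-s) * p y ≤ C)
    (a : ℝ) (ha : 0 < a) (haδ : a / 4 * δ ^ 2 ≤ 1) (z : V) :
    ∑ x : X, p x * Real.exp (-(a * dist (x:V) z ^ 2)) ≤ 
      (1 + (s/2)^(s/2)) * (1/4 : ℝ) ^ (-(s/2)) * C * a ^ (-(s/2)) := by
  classical
  have hne : (Finset.univ.filter (fun x : X => p x ≠ 0)).Nonempty := by
    by_contra h
    rw [Finset.not_nonempty_iff_eq_empty, Finset.filter_eq_empty_iff] at h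
    have : ∑ x, p x = 0 := Finset.sum_eq_zero fun x hx => by simpa using h hx
    linarith
  obtain ⟨z0, hz0, hmin⟩ := Finset.exists_min_image _ (fun x : X => dist (x:V) z) hne
  have hz0' : p z0 ≠ 0 := by simpa using hz0
  calc ∑ x : X, p x * Real.exp (-(a * dist (x:V) z ^ 2)) 
      ≤ ∑ x : X, p x * ((1 + (s/2)^(s/2)) * (a/4) ^ (-(s/2)) * (max (dist (z0:V) (x:V)) δ) ^ (-s)) := by
        apply Finset.sum_le_sum
        intro x _
        by_cases hx : p x = 0
        · simp [hx]
        refine mul_le_mul_of_nonneg_left ?_ (hp0 x)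
        refine le_trans ?_ (gauss_le_kernel s (a/4) (dist (z0:V) (x:V)) δ hs (by positivity) hδ haδ)
        apply Real.exp_le_exp.2
        have h1 := hmin x (by simpa using hx)
        have h2 := dist_triangle_right (z0:V) (x:V) z
        have h3 : dist (z0:V) (x:V) ≤ 2 * dist (x:V) z := by linarith
        have h4 : dist (z0:V) (x:V) ^ 2 ≤ (2 * dist (x:V) z)^2 := 
          pow_le_pow_left₀ dist_nonneg h3 2
        nlinarith
    _ = (1 + (s/2)^(s/2)) * (a/4) ^ (-(s/2)) * ∑ x : X, (max (dist (z0:V) (x:V)) δ) ^ (-s) * p x := by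
        rw [Finset.mul_sum]; exact Finset.sum_congr rfl fun x _ => by ring
    _ ≤ (1 + (s/2)^(s/2)) * (a/4) ^ (-(s/2)) * C := by
        apply mul_le_mul_of_nonneg_left (hC z0 hz0')
        positivity
    _ = _ := by
        rw [div_eq_mul_one_div a 4, Real.mul_rpow ha.le (by norm_num)]; ring

lemma frostman_gauss {V : Type*} [MetricSpace V] [MeasurableSpace V] [BorelSpace V]
    (E : Set V) (hE : IsCompact E) (s ε : ℝ) (hs : 0 < s) (hε : 0 < ε)
    (hH : μH[s + ε] E ≠ 0) :
    ∃ μ : Measure V, IsProbabilityMeasure μ ∧ μ Eᶜ = 0 ∧ ∃ C : ℝ, ∀ a : ℝ, 0 < a → ∀ z : V,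
      ∫ x, Real.exp (-(a * dist x z ^ 2)) ∂μ ≤ C * a ^ (-(s/2)) := by
  classical
  obtain ⟨C, hC⟩ := discrete_frostman E hE s ε hs hε hH
  choose X p hXE hp0 hp1 hU using hC
  let P0 : ℕ → Measure V := fun N => ∑ x : X N, ENNReal.ofReal (p N x) • Measure.dirac (x:V)
  have hP0 : ∀ N, IsProbabilityMeasure (P0 N) := by
    intro N
    constructor
    simp only [P0, Measure.finsetSum_apply, Measure.smul_apply, measure_univ, smul_eq_mul, mul_one]
    rw [← ENNReal.ofReal_sum_of_nonneg (fun x _ => hp0 N x), hp1]; simp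
  have hP0E : ∀ N, P0 N Eᶜ = 0 := by
    intro N
    simp only [P0, Measure.finsetSum_apply, Measure.smul_apply, smul_eq_mul]
    apply Finset.sum_eq_zero
    intro x _
    rw [Measure.dirac_apply' _ hE.measurableSet.compl]
    have : (x:V) ∈ E := hXE N x.2
    simp [this]
  have hInt : ∀ N (f : V → ℝ), Continuous f → ∫ x, f x ∂(P0 N) = ∑ x : X N, p N x * f x := by
    intro N f hf
    simp only [P0]
    rw [integral_finsetSum_measure]
    · refine Finset.sum_congr rfl fun x _ => ?_
      rw [integral_smul_measure, integral_dirac' _ _ hf.stronglyMeasurable, ENNReal.toReal_ofReal (hp0 N x),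
        smul_eq_mul]
    · intro x _
      exact (integrable_dirac' hf.stronglyMeasurable (by simp)).smul_measure (by simp)
  let P : ℕ → ProbabilityMeasure V := fun N => ⟨P0 N, hP0 N⟩
  have hcomp := isCompact_setOfPred_probabilityMeasure_mass_eq_compl_isCompact_le (E := V) 
    (u := fun _ => 0) (K := fun _ => E) tendsto_const_nhds (fun _ => hE) (Or.inl inferInstance)
  obtain ⟨μ, hμ, hlim⟩ := hcomp.ultrafilter_le_nhds' ((Filter.hyperfilter ℕ).map P) (by
    refine Ultrafilter.mem_map.2 (Filter.mem_of_superset Filter.univ_mem ?_)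
    intro N _ n
    change P N Eᶜ ≤ 0
    rw [← ENNReal.coe_le_coe, ProbabilityMeasure.ennreal_coeFn_eq_coeFn_toMeasure]
    exact (hP0E N).le)
  have hlim' : Filter.Tendsto P (Filter.hyperfilter ℕ) (nhds μ) := hlim
  refine ⟨μ, inferInstance, ?_, (1 + (s/2)^(s/2)) * (1/4 : ℝ) ^ (-(s/2)) * C, fun a ha z => ?_⟩
  · have := hμ 0
    rw [← ENNReal.coe_le_coe, ProbabilityMeasure.ennreal_coeFn_eq_coeFn_toMeasure] at this
    simpa using this
  rw [ProbabilityMeasure.tendsto_iff_forall_integral_tendsto] at hlim'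
  have hcont : Continuous (fun x : V => Real.exp (-(a * dist x z ^ 2))) := by fun_prop
  let g : BoundedContinuousFunction V ℝ := BoundedContinuousFunction.ofNormedAddCommGroup 
    (fun x : V => Real.exp (-(a * dist x z ^ 2))) hcont 1 (fun x => by
      rw [Real.norm_eq_abs, Real.abs_exp]
      apply Real.exp_le_one_iff.2
      have : 0 ≤ a * dist x z ^ 2 := by positivity
      linarith)
  refine le_of_tendsto (hlim' g) ?_
  have hev : ∀ᶠ N : ℕ in Filter.atTop, a / 4 * ((1/2 : ℝ)^N) ^ 2 ≤ 1 := by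
    have h1 : Filter.Tendsto (fun N : ℕ => a / 4 * ((1/2 : ℝ)^N) ^ 2) Filter.atTop (nhds 0) := by
      have := ((tendsto_pow_atTop_nhds_zero_of_lt_one (r := (1/2:ℝ)) (by norm_num) 
        (by norm_num)).pow 2).const_mul (a/4)
      simpa using this
    exact (h1.eventually_lt_const (by norm_num : (0:ℝ) < 1)).mono fun N h => h.le
  filter_upwards [Nat.hyperfilter_le_atTop hev] with N hN
  have : ∫ x, g x ∂(P N : Measure V) = ∑ x : X N, p N x * Real.exp (-(a * dist (x:V) z ^ 2)) := 
    hInt N _ hcont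
  rw [this]
  exact discrete_gauss (X N) (p N) (hp0 N) (hp1 N) s C _ hs (by positivity) (hU N) a ha hN z


section FourierPart

variable {V : Type*} [NormedAddCommGroup V] [InnerProductSpace ℝ V] [FiniteDimensional ℝ V]
  [MeasurableSpace V] [BorelSpace V]

lemma gauss_integrable (b : ℝ) (hb : 0 < b) (x : V) :
    Integrable (fun z : V => Real.exp (-(b * ‖x - z‖ ^ 2))) := by
  have h := GaussianFourier.integrable_cexp_neg_mul_sq_norm_add (V := V) (b := (b:ℂ)) 
    (by simpa using hb) 0 0
  have h2 : Integrable (fun z : V => Real.exp (-(b * ‖z‖ ^ 2))) := by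
    have := h.re
    refine this.congr (Filter.Eventually.of_forall fun z => ?_)
    simp only [zero_mul, add_zero]
    rw [show -(b:ℂ) * (‖z‖:ℂ)^2 = ((-(b * ‖z‖^2) : ℝ) : ℂ) by push_cast; ring, ← Complex.ofReal_exp]
    rfl
  exact h2.comp_sub_left x

lemma gauss_ft (b : ℝ) (hb : 0 < b) (y : V) :
    ∫ w : V, (Real.exp (-(b * ‖w‖ ^ 2)) : ℂ) * Complex.exp (Complex.I * (inner ℝ w y : ℝ)) =
      (((Real.pi / b) ^ ((Module.finrank ℝ V : ℝ) / 2) * Real.exp (-(‖y‖ ^ 2 / (4 * b))) : ℝ) : ℂ) := by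
  have h := GaussianFourier.integral_cexp_neg_mul_sq_norm_add (V := V) (b := (b:ℂ)) 
    (by simpa using hb) Complex.I y
  have e1 : ∀ w : V, (Real.exp (-(b * ‖w‖ ^ 2)) : ℂ) * Complex.exp (Complex.I * (inner ℝ w y : ℝ)) 
      = Complex.exp (-(b:ℂ) * ‖w‖^2 + Complex.I * (inner ℝ y w : ℝ)) := by
    intro w
    rw [Complex.exp_add, real_inner_comm]
    push_cast
    congr 2
    ring
  simp only [e1, h]
  push_cast
  rw [Complex.ofReal_cpow (by positivity)]
  push_cast
  congr 2
  rw [Complex.I_sq]; ring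

lemma gauss_repr (l : ℝ) (hl : l ≠ 0) (x y : V) :
    ∫ z : V, (Real.exp (-(l^2/2 * ‖x - z‖ ^ 2)) : ℂ) * Complex.exp (Complex.I * (inner ℝ z (l • y) : ℝ)) =
      (((2 * Real.pi / l^2) ^ ((Module.finrank ℝ V : ℝ) / 2) : ℝ) : ℂ) * 
        ((Real.exp (-(‖y‖ ^ 2 / 2)) : ℝ) : ℂ) * Complex.exp (Complex.I * (inner ℝ x (l • y) : ℝ)) := by
  have hl2 : 0 < l^2 := by positivity
  rw [← integral_add_left_eq_self _ x]
  have e1 : ∀ w : V, (Real.exp (-(l^2/2 * ‖x - (x + w)‖ ^ 2)) : ℂ) * 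
      Complex.exp (Complex.I * (inner ℝ (x + w) (l • y) : ℝ)) = 
      Complex.exp (Complex.I * (inner ℝ x (l • y) : ℝ)) * 
      ((Real.exp (-(l^2/2 * ‖w‖ ^ 2)) : ℂ) * Complex.exp (Complex.I * (inner ℝ w (l • y) : ℝ))) := by
    intro w
    rw [inner_add_left]
    push_cast
    rw [mul_add, Complex.exp_add]
    simp only [sub_add_cancel_left, norm_neg]
    ring
  simp only [e1]
  rw [integral_const_mul, gauss_ft (l^2/2) (by positivity)]
  rw [norm_smul, mul_pow, Real.norm_eq_abs, sq_abs]
  have e2 : Real.pi / (l^2/2) = 2 * Real.pi / l^2 := by field_simp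
  have e3 : l^2 * ‖y‖^2 / (4 * (l^2/2)) = ‖y‖^2/2 := by field_simp; ring
  rw [e2, e3]
  push_cast
  ring

/-- Fourier transform of `f μ` at frequency `l x`. -/
noncomputable def FTm (μ : Measure V) (f : V → ℂ) (l : ℝ) (x : V) : ℂ :=
  ∫ y, Complex.exp (Complex.I * (inner ℝ x (l • y) : ℝ)) * f y ∂μ

lemma norm_cexp_I (t : ℝ) : ‖Complex.exp (Complex.I * (t : ℂ))‖ = 1 := by
  rw [mul_comm]; exact Complex.norm_exp_ofReal_mul_I t

set_option linter.unusedSectionVars false in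
lemma FTm_norm_le (μ : Measure V) [IsProbabilityMeasure μ] (f : V → ℂ) (B : ℝ) 
    (hB : ∀ y, ‖f y‖ ≤ B) (l : ℝ) (x : V) : ‖FTm μ f l x‖ ≤ B := by
  have := norm_integral_le_of_norm_le_const (μ := μ) 
    (f := fun y => Complex.exp (Complex.I * (inner ℝ x (l • y) : ℝ)) * f y) (C := B)
    (Filter.Eventually.of_forall fun y => by rw [norm_mul, norm_cexp_I, one_mul]; exact hB y)
  simpa [FTm] using this

lemma FTm_continuous (μ : Measure V) [IsProbabilityMeasure μ] (f : V → ℂ) (hf : Measurable f) (B : ℝ) 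
    (hB : ∀ y, ‖f y‖ ≤ B) (l : ℝ) : Continuous (FTm μ f l) := by
  unfold FTm
  refine continuous_of_dominated (bound := fun _ => B) ?_ ?_ (integrable_const B) ?_
  · intro x
    exact Measurable.aestronglyMeasurable (by fun_prop)
  · intro x
    exact Filter.Eventually.of_forall fun y => by rw [norm_mul, norm_cexp_I, one_mul]; exact hB y
  · exact Filter.Eventually.of_forall fun y => by fun_prop

lemma FTm_repr (μ : Measure V) [IsProbabilityMeasure μ] (f : V → ℂ) (hf : Measurable f) (B : ℝ) 
    (hB : ∀ y, ‖(Real.exp (‖y‖^2/2) : ℂ) * f y‖ ≤ B) (l : ℝ) (hl : l ≠ 0) (x : V) :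
    (((2 * Real.pi / l^2) ^ ((Module.finrank ℝ V : ℝ) / 2) : ℝ) : ℂ) * FTm μ f l x =
      ∫ z, (Real.exp (-(l^2/2 * ‖x - z‖ ^ 2)) : ℂ) * 
        FTm μ (fun y => (Real.exp (‖y‖^2/2) : ℂ) * f y) l z := by
  have hl2 : 0 < l^2 := by positivity
  set g : V → ℂ := fun y => (Real.exp (‖y‖^2/2) : ℂ) * f y with hg
  have hgm : Measurable g := by fun_prop
  have hgi : Integrable g μ := Integrable.of_bound hgm.aestronglyMeasurable B 
    (Filter.Eventually.of_forall hB)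
  unfold FTm
  simp only [← integral_const_mul]
  rw [integral_integral_swap]
  · refine integral_congr_ae (Filter.Eventually.of_forall fun y => ?_)
    simp only
    have := gauss_repr l hl x y
    simp only [← mul_assoc]
    rw [integral_mul_const, this]
    simp only [hg]
    have h1 : ((Real.exp (-(‖y‖^2/2)) : ℝ) : ℂ) * (Real.exp (‖y‖^2/2) : ℝ) = 1 := by
      rw [← Complex.ofReal_mul, ← Real.exp_add]; simp
    linear_combination (-((((2 * Real.pi / l^2) ^ ((Module.finrank ℝ V : ℝ) / 2) : ℝ) : ℂ) *  
       Complex.exp (Complex.I * (inner ℝ x (l • y) : ℝ)) * f y)) * h1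
  · have h1 : Integrable (fun q : V × V => (Real.exp (-(l^2/2 * ‖x - q.1‖ ^ 2)) : ℂ) * g q.2) 
        (volume.prod μ) := (gauss_integrable (l^2/2) (by positivity) x).ofReal.mul_prod hgi
    have h2 := h1.bdd_mul (c := 1) 
      (f := fun q : V × V => Complex.exp (Complex.I * (inner ℝ q.1 (l • q.2) : ℝ))) 
      (Measurable.aestronglyMeasurable (by fun_prop)) (Filter.Eventually.of_forall fun q => 
        (norm_cexp_I _).le)
    refine h2.congr (Filter.Eventually.of_forall fun q => ?_)
    simp only [Function.uncurry]
    ring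

lemma weighted_cs {α : Type*} [MeasurableSpace α] (μ : Measure α) (w h : α → ℝ) (hw : ∀ x, 0 ≤ w x)
    (hwi : Integrable w μ) (hwh : Integrable (fun x => w x * h x) μ)
    (hwh2 : Integrable (fun x => w x * h x ^ 2) μ) (hpos : 0 < ∫ x, w x ∂μ) :
    (∫ x, w x * h x ∂μ) ^ 2 ≤ (∫ x, w x ∂μ) * ∫ x, w x * h x ^ 2 ∂μ := by
  set W := ∫ x, w x ∂μ
  set M := ∫ x, w x * h x ∂μ with hM
  have h0 : 0 ≤ ∫ x, w x * (W * h x - M) ^ 2 ∂μ := 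
    integral_nonneg fun x => mul_nonneg (hw x) (sq_nonneg _)
  have h1 : ∫ x, w x * (W * h x - M) ^ 2 ∂μ = 
      W^2 * (∫ x, w x * h x ^ 2 ∂μ) - 2 * W * M * M + M^2 * W := by
    have : ∀ x, w x * (W * h x - M)^2 = W^2 * (w x * h x ^2) - 2 * W * M * (w x * h x) + M^2 * w x := by
      intro x; ring
    simp only [this]
    rw [integral_add (f := fun x => W^2 * (w x * h x ^2) - 2 * W * M * (w x * h x)) 
      ((hwh2.const_mul _).sub (hwh.const_mul _)) (hwi.const_mul _), 
      integral_sub (hwh2.const_mul _) (hwh.const_mul _)]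
    simp only [integral_const_mul]
    rfl
  rw [h1] at h0
  have h2 : 0 ≤ W * (W * (∫ x, w x * h x ^ 2 ∂μ) - M^2) := by nlinarith
  have := nonneg_of_mul_nonneg_right h2 hpos
  linarith

lemma FTm_pointwise (μ : Measure V) [IsProbabilityMeasure μ] (f : V → ℂ) (hf : Measurable f) (B : ℝ) 
    (hB : ∀ y, ‖(Real.exp (‖y‖^2/2) : ℂ) * f y‖ ≤ B) (l : ℝ) (hl : l ≠ 0) (x : V) :
    (2 * Real.pi / l^2) ^ ((Module.finrank ℝ V : ℝ) / 2) * ‖FTm μ f l x‖ ^ 2 ≤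
      ∫ z, Real.exp (-(l^2/2 * ‖x - z‖ ^ 2)) * 
        ‖FTm μ (fun y => (Real.exp (‖y‖^2/2) : ℂ) * f y) l z‖ ^ 2 := by
  have hl2 : 0 < l^2 := by positivity
  set g : V → ℂ := fun y => (Real.exp (‖y‖^2/2) : ℂ) * f y with hg
  have hgm : Measurable g := by fun_prop
  have hc := FTm_continuous μ g hgm B hB l
  have hb := FTm_norm_le μ g B hB l
  have hB0 : 0 ≤ B := (norm_nonneg _).trans (hB 0)
  set A := (2 * Real.pi / l^2) ^ ((Module.finrank ℝ V : ℝ) / 2) with hA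
  have hApos : 0 < A := by positivity
  have hgi := gauss_integrable (l^2/2) (by positivity) x
  have hWA : ∫ z : V, Real.exp (-(l^2/2 * ‖x - z‖ ^ 2)) = A := by
    have := gauss_repr l hl x 0
    simp at this
    rw [hA]
    have h2 : ((∫ z : V, Real.exp (-(l^2/2 * ‖x - z‖ ^ 2)) : ℝ) : ℂ) = (A : ℂ) := by
      rw [← integral_complex_ofReal]
      push_cast
      simpa using this
    exact_mod_cast h2
  have i1 : Integrable (fun z => Real.exp (-(l^2/2 * ‖x - z‖ ^ 2)) * ‖FTm μ g l z‖) := by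
    refine (hgi.bdd_mul (c := B) (f := fun z => ‖FTm μ g l z‖) hc.norm.aestronglyMeasurable 
      (Filter.Eventually.of_forall fun z => by simpa using hb z)).congr 
      (Filter.Eventually.of_forall fun z => ?_)
    simp only; ring
  have i2 : Integrable (fun z => Real.exp (-(l^2/2 * ‖x - z‖ ^ 2)) * ‖FTm μ g l z‖^2) := by
    refine (hgi.bdd_mul (c := B^2) (f := fun z => ‖FTm μ g l z‖^2) (hc.norm.pow 2).aestronglyMeasurable 
      (Filter.Eventually.of_forall fun z => ?_)).congr 
      (Filter.Eventually.of_forall fun z => ?_)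
    · rw [norm_pow, norm_norm]; exact pow_le_pow_left₀ (norm_nonneg _) (hb z) 2
    simp only; ring
  have cs := weighted_cs volume (fun z => Real.exp (-(l^2/2 * ‖x - z‖ ^ 2))) (fun z => ‖FTm μ g l z‖)
    (fun z => (Real.exp_pos _).le) hgi i1 i2 (by rw [hWA]; exact hApos)
  have h1 : A * ‖FTm μ f l x‖ ≤ ∫ z, Real.exp (-(l^2/2 * ‖x - z‖ ^ 2)) * ‖FTm μ g l z‖ := by
    have h := FTm_repr μ f hf B hB l hl x
    have : A * ‖FTm μ f l x‖ = ‖(A:ℂ) * FTm μ f l x‖ := by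
      rw [norm_mul, Complex.norm_real, Real.norm_eq_abs, abs_of_pos hApos]
    rw [this, hA, h]
    refine (norm_integral_le_integral_norm _).trans_eq ?_
    refine integral_congr_ae (Filter.Eventually.of_forall fun z => ?_)
    simp only
    rw [norm_mul, Complex.norm_real, Real.norm_eq_abs, Real.abs_exp]
  rw [hWA] at cs
  have h2 : (A * ‖FTm μ f l x‖)^2 ≤ (∫ z, Real.exp (-(l^2/2 * ‖x - z‖ ^ 2)) * ‖FTm μ g l z‖)^2 := 
    pow_le_pow_left₀ (by positivity) h1 2
  have h3 : A * (A * ‖FTm μ f l x‖^2) ≤ 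
    A * ∫ z, Real.exp (-(l^2/2 * ‖x - z‖ ^ 2)) * ‖FTm μ g l z‖^2 := by
    calc _ = (A * ‖FTm μ f l x‖)^2 := by ring
      _ ≤ _ := h2.trans cs
  exact le_of_mul_le_mul_left h3 hApos

lemma FTm_energy (μ : Measure V) [IsProbabilityMeasure μ] (s C : ℝ) 
    (hG : ∀ a : ℝ, 0 < a → ∀ z : V, ∫ x, Real.exp (-(a * dist x z ^ 2)) ∂μ ≤ C * a ^ (-(s/2)))
    (g : V → ℂ) (hg : Measurable g) (B : ℝ) (hB : ∀ y, ‖g y‖ ≤ B) (l : ℝ) (hl : l ≠ 0) :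
    ∫ z, Real.exp (-(1/8 * ‖z‖^2)) * ‖FTm μ g l z‖^2 ≤ 
      (8 * Real.pi) ^ ((Module.finrank ℝ V : ℝ) / 2) * B^2 * C * (2 * l^2) ^ (-(s/2)) := by
  have hl2 : 0 < l^2 := by positivity
  have hB0 : 0 ≤ B := (norm_nonneg _).trans (hB 0)
  set A := (8 * Real.pi) ^ ((Module.finrank ℝ V : ℝ) / 2) with hA
  have hApos : 0 < A := by positivity
  have hgi : Integrable g μ := Integrable.of_bound hg.aestronglyMeasurable B 
    (Filter.Eventually.of_forall hB)
  have h1 : ∀ z, ((‖FTm μ g l z‖^2 : ℝ) : ℂ) = ∫ q : V × V, 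
      Complex.exp (Complex.I * (inner ℝ z (l • (q.1 - q.2)) : ℝ)) * (g q.1 * star (g q.2)) ∂(μ.prod μ) := by
    intro z
    have e : ((‖FTm μ g l z‖^2 : ℝ) : ℂ) = FTm μ g l z * star (FTm μ g l z) := by
      have := Complex.mul_conj' (FTm μ g l z)
      push_cast
      exact this.symm
    rw [e]
    unfold FTm
    have e2 : star (∫ y, Complex.exp (Complex.I * (inner ℝ z (l • y) : ℝ)) * g y ∂μ) = 
      ∫ y, star (Complex.exp (Complex.I * (inner ℝ z (l • y) : ℝ)) * g y) ∂μ := 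
      (integral_conj (𝕜 := ℂ)).symm
    rw [e2, ← integral_prod_mul]
    refine integral_congr_ae (Filter.Eventually.of_forall fun q => ?_)
    simp only [star_mul']
    have e3 : star (Complex.exp (Complex.I * (inner ℝ z (l • q.2) : ℝ))) = 
        Complex.exp (-(Complex.I * (inner ℝ z (l • q.2) : ℝ))) := by
      change (starRingEnd ℂ) _ = _
      rw [← Complex.exp_conj]
      simp
    rw [e3, smul_sub, inner_sub_right]
    push_cast
    rw [mul_sub, sub_eq_add_neg, Complex.exp_add]
    ring
  have h2 : ((∫ z, Real.exp (-(1/8 * ‖z‖^2)) * ‖FTm μ g l z‖^2 : ℝ) : ℂ) = 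
      ∫ q : V × V, ((A * Real.exp (-(2 * l^2 * dist q.1 q.2 ^ 2)) : ℝ) : ℂ) * (g q.1 * star (g q.2)) 
        ∂(μ.prod μ) := by
    rw [← integral_complex_ofReal]
    simp only [Complex.ofReal_mul (Real.exp _)]
    simp only [h1, ← integral_const_mul]
    rw [integral_integral_swap]
    · refine integral_congr_ae (Filter.Eventually.of_forall fun q => ?_)
      simp only [← mul_assoc]
      rw [integral_mul_const, integral_mul_const, gauss_ft (1/8) (by norm_num)]
      congr 4
      · rw [hA]; congr 1; ring
      · rw [norm_smul, mul_pow, Real.norm_eq_abs, sq_abs, dist_eq_norm]; ring_nf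
    · have hgg : Integrable (fun q : V × V => g q.1 * star (g q.2)) (μ.prod μ) := 
        hgi.mul_prod (Complex.conjCLE.toContinuousLinearMap.integrable_comp hgi)
      have hga : Integrable (fun z : V => Real.exp (-(1/8 * ‖z‖^2))) := by
        simpa using gauss_integrable (1/8) (by norm_num) (0 : V)
      have i1 : Integrable (fun q : V × (V × V) => (Real.exp (-(1/8 * ‖q.1‖ ^ 2)) : ℂ) * 
        (g q.2.1 * star (g q.2.2))) (volume.prod (μ.prod μ)) := hga.ofReal.mul_prod hgg
      have i2 := i1.bdd_mul (c := 1) 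
        (f := fun q : V × (V × V) => Complex.exp (Complex.I * (inner ℝ q.1 (l • (q.2.1 - q.2.2)) : ℝ))) 
        (Measurable.aestronglyMeasurable (by fun_prop)) (Filter.Eventually.of_forall fun q => 
          (norm_cexp_I _).le)
      refine i2.congr (Filter.Eventually.of_forall fun q => ?_)
      simp only [Function.uncurry]
      ring
  have hexp1 : ∀ q : V × V, Real.exp (-(2 * l^2 * dist q.1 q.2 ^ 2)) ≤ 1 := fun q => 
    Real.exp_le_one_iff.2 (by 
      have : 0 ≤ 2 * l^2 * dist q.1 q.2 ^ 2 := by positivity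
      linarith)
  have hei : Integrable (fun q : V × V => Real.exp (-(2 * l^2 * dist q.1 q.2 ^ 2))) (μ.prod μ) := by
    refine Integrable.of_bound (Measurable.aestronglyMeasurable (by fun_prop)) 1 
      (Filter.Eventually.of_forall fun q => ?_)
    rw [Real.norm_eq_abs, Real.abs_exp]; exact hexp1 q
  have h3 : ∫ z, Real.exp (-(1/8 * ‖z‖^2)) * ‖FTm μ g l z‖^2 ≤ 
      ∫ q : V × V, A * B^2 * Real.exp (-(2 * l^2 * dist q.1 q.2 ^ 2)) ∂(μ.prod μ) := by
    have hnn : 0 ≤ ∫ z, Real.exp (-(1/8 * ‖z‖^2)) * ‖FTm μ g l z‖^2 := 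
      integral_nonneg fun z => by positivity
    calc _ = ‖((∫ z, Real.exp (-(1/8 * ‖z‖^2)) * ‖FTm μ g l z‖^2 : ℝ) : ℂ)‖ := by
          rw [Complex.norm_real, Real.norm_eq_abs, abs_of_nonneg hnn]
      _ ≤ _ := by
          rw [h2]
          refine norm_integral_le_of_norm_le (hei.const_mul _) (Filter.Eventually.of_forall fun q => ?_)
          rw [norm_mul, norm_mul, norm_star, Complex.norm_real, Real.norm_eq_abs, 
            abs_of_nonneg (by positivity)]
          have := mul_le_mul (hB q.1) (hB q.2) (norm_nonneg _) hB0
          calc _ ≤ A * Real.exp (-(2 * l^2 * dist q.1 q.2 ^ 2)) * (B * B) := by gcongr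
            _ = _ := by ring
  have h4 : ∫ q : V × V, Real.exp (-(2 * l^2 * dist q.1 q.2 ^ 2)) ∂(μ.prod μ) ≤ 
      C * (2 * l^2) ^ (-(s/2)) := by
    rw [integral_prod_symm _ hei]
    calc _ ≤ ∫ _ : V, C * (2 * l^2) ^ (-(s/2)) ∂μ := 
          integral_mono hei.integral_prod_right (integrable_const _) 
            (fun z => hG (2 * l^2) (by positivity) z)
      _ = _ := by simp
  rw [integral_const_mul] at h3
  calc _ ≤ _ := h3
    _ ≤ A * B^2 * (C * (2 * l^2) ^ (-(s/2))) := mul_le_mul_of_nonneg_left h4 (by positivity)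
    _ = _ := by ring

lemma FTm_L2 (μ : Measure V) [IsProbabilityMeasure μ] (s C R : ℝ) 
    (hG : ∀ a : ℝ, 0 < a → ∀ z : V, ∫ x, Real.exp (-(a * dist x z ^ 2)) ∂μ ≤ C * a ^ (-(s/2)))
    (hR : ∀ᵐ x ∂μ, ‖x‖ ≤ R) (hR0 : 0 ≤ R) :
    ∃ K : ℝ, ∀ f : V → ℂ, Measurable f → (∀ y, ‖f y‖ ≤ 1) → (∀ y, R < ‖y‖ → f y = 0) → 
      ∀ l : ℝ, 1 ≤ l^2 → 
        ∫ x, ‖FTm μ f l x‖^2 ∂μ ≤ K * (l^2) ^ ((Module.finrank ℝ V : ℝ)/2 - s) := by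
  have hC : 0 ≤ C := by
    have h := hG 1 one_pos 0
    rw [Real.one_rpow, mul_one] at h
    exact (integral_nonneg fun x => (Real.exp_pos _).le).trans h
  set n : ℝ := (Module.finrank ℝ V : ℝ) with hn
  set B := Real.exp (R^2/2) with hBdef
  refine ⟨((2 * Real.pi)^(n/2))⁻¹ * Real.exp (R^2/4) * C * (1/4)^(-(s/2)) * 
    ((8 * Real.pi) ^ (n / 2) * B^2 * C * 2 ^ (-(s/2))), ?_⟩
  intro f hf hf1 hfR l hl1
  have hl2 : 0 < l^2 := by linarith
  have hl : l ≠ 0 := by rintro rfl; norm_num at hl2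
  have hB : ∀ y, ‖(Real.exp (‖y‖^2/2) : ℂ) * f y‖ ≤ B := by
    intro y
    by_cases hy : R < ‖y‖
    · rw [hfR y hy]; simp [hBdef]; positivity
    · push Not at hy
      rw [norm_mul, Complex.norm_real, Real.norm_eq_abs, Real.abs_exp]
      calc _ ≤ Real.exp (‖y‖^2/2) * 1 := by gcongr; exact hf1 y
        _ ≤ B := by rw [mul_one, hBdef]; gcongr
  set g : V → ℂ := fun y => (Real.exp (‖y‖^2/2) : ℂ) * f y with hg
  have hgm : Measurable g := by fun_prop
  have hc := FTm_continuous μ g hgm B hB l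
  have hb := FTm_norm_le μ g B hB l
  have hcf := FTm_continuous μ f hf 1 hf1 l
  have hbf := FTm_norm_le μ f 1 hf1 l
  set A := (2 * Real.pi / l^2) ^ (n / 2) with hA
  have hApos : 0 < A := by positivity
  -- the modified integrand
  let Φ : V → V → ℝ := fun x z => Real.exp (R^2/4) * (Real.exp (-(l^2/4 * dist x z ^2)) * 
    (Real.exp (-(1/8 * ‖z‖^2)) * ‖FTm μ g l z‖^2))
  have hga : Integrable (fun z : V => Real.exp (-(1/8 * ‖z‖^2))) := by
    simpa using gauss_integrable (1/8) (by norm_num) (0 : V)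
  have hgH : Integrable (fun z : V => Real.exp (-(1/8 * ‖z‖^2)) * ‖FTm μ g l z‖^2) := by
    refine (hga.bdd_mul (c := B^2) (f := fun z => ‖FTm μ g l z‖^2) (hc.norm.pow 2).aestronglyMeasurable 
      (Filter.Eventually.of_forall fun z => ?_)).congr 
      (Filter.Eventually.of_forall fun z => ?_)
    · rw [norm_pow, norm_norm]; exact pow_le_pow_left₀ (norm_nonneg _) (hb z) 2
    simp only; ring
  have hexp1 : ∀ x z : V, Real.exp (-(l^2/4 * dist x z ^ 2)) ≤ 1 := fun x z => 
    Real.exp_le_one_iff.2 (by 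
      have : 0 ≤ l^2/4 * dist x z ^ 2 := by positivity
      linarith)
  have hΦ : Integrable (Function.uncurry Φ) (μ.prod volume) := by
    have i1 : Integrable (fun q : V × V => (1:ℝ) * (Real.exp (-(1/8 * ‖q.2‖^2)) * ‖FTm μ g l q.2‖^2))
      (μ.prod volume) := (integrable_const (μ := μ) (1:ℝ)).mul_prod hgH
    have i2 := (i1.bdd_mul (c := 1) 
      (f := fun q : V × V => Real.exp (-(l^2/4 * dist q.1 q.2 ^2))) 
      (Measurable.aestronglyMeasurable (by fun_prop)) (Filter.Eventually.of_forall fun q => by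
        rw [Real.norm_eq_abs, Real.abs_exp]; exact hexp1 _ _)).const_mul (Real.exp (R^2/4))
    refine i2.congr (Filter.Eventually.of_forall fun q => ?_)
    simp only [Function.uncurry, Φ]
    ring
  have hΦx : ∀ x, Integrable (Φ x) := by
    intro x
    refine (hgH.bdd_mul (c := 1) 
      (f := fun z : V => Real.exp (-(l^2/4 * dist x z ^2))) 
      (Measurable.aestronglyMeasurable (by fun_prop)) (Filter.Eventually.of_forall fun q => by
        rw [Real.norm_eq_abs, Real.abs_exp]; exact hexp1 _ _)).const_mul (Real.exp (R^2/4))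
  have h1 : ∀ᵐ x ∂μ, A * ‖FTm μ f l x‖^2 ≤ ∫ z, Φ x z := by
    filter_upwards [hR] with x hx
    refine (FTm_pointwise μ f hf B hB l hl x).trans ?_
    refine integral_mono_of_nonneg (Filter.Eventually.of_forall fun z => by positivity) (hΦx x) 
      (Filter.Eventually.of_forall fun z => ?_)
    simp only [Φ]
    rw [← mul_assoc, ← mul_assoc, ← Real.exp_add, ← Real.exp_add]
    refine mul_le_mul_of_nonneg_right (Real.exp_le_exp.2 ?_) (by positivity)
    rw [dist_eq_norm]
    have t1 : ‖z‖ ≤ ‖x‖ + ‖x - z‖ := by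
      have := norm_sub_le x (x - z)
      simpa using this
    have t2 : ‖z‖ ≤ R + ‖x - z‖ := by linarith
    have t3 : ‖z‖^2 ≤ (R + ‖x - z‖)^2 := pow_le_pow_left₀ (norm_nonneg _) t2 2
    have t4 : ‖x - z‖^2 ≤ l^2 * ‖x - z‖^2 := le_mul_of_one_le_left (by positivity) hl1
    nlinarith [sq_nonneg (R - ‖x - z‖)]
  have hfi : Integrable (fun x => A * ‖FTm μ f l x‖^2) μ := by
    refine (Integrable.of_bound (hcf.norm.pow 2).aestronglyMeasurable 1 
      (Filter.Eventually.of_forall fun x => ?_)).const_mul A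
    change ‖‖FTm μ f l x‖ ^ 2‖ ≤ 1
    rw [norm_pow, norm_norm]; exact pow_le_one₀ (norm_nonneg _) (hbf x)
  have h2 : A * ∫ x, ‖FTm μ f l x‖^2 ∂μ ≤ ∫ z, ∫ x, Φ x z ∂μ := by
    rw [← integral_const_mul, ← integral_integral_swap hΦ]
    exact integral_mono_ae hfi hΦ.integral_prod_left h1
  have h3 : ∫ z, ∫ x, Φ x z ∂μ ≤ Real.exp (R^2/4) * (C * (l^2/4)^(-(s/2))) * 
      ∫ z, Real.exp (-(1/8 * ‖z‖^2)) * ‖FTm μ g l z‖^2 := by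
    rw [← integral_const_mul]
    refine integral_mono hΦ.integral_prod_right (hgH.const_mul _) fun z => ?_
    simp only [Φ, Function.uncurry]
    rw [integral_const_mul, integral_mul_const, mul_assoc]
    refine mul_le_mul_of_nonneg_left ?_ (Real.exp_pos _).le
    exact mul_le_mul_of_nonneg_right (hG (l^2/4) (by positivity) z) (by positivity)
  have h4 := FTm_energy μ s C hG g hgm B hB l hl
  have h5 : A * ∫ x, ‖FTm μ f l x‖^2 ∂μ ≤ Real.exp (R^2/4) * (C * (l^2/4)^(-(s/2))) * 
      ((8 * Real.pi) ^ (n / 2) * B^2 * C * (2 * l^2) ^ (-(s/2))) := 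
    (h2.trans h3).trans (mul_le_mul_of_nonneg_left h4 (by positivity))
  have h6 : ∫ x, ‖FTm μ f l x‖^2 ∂μ ≤ A⁻¹ * (Real.exp (R^2/4) * (C * (l^2/4)^(-(s/2))) * 
      ((8 * Real.pi) ^ (n / 2) * B^2 * C * (2 * l^2) ^ (-(s/2)))) := by
    rw [← div_eq_inv_mul, le_div_iff₀ hApos, mul_comm]; exact h5
  refine h6.trans_eq ?_
  have e1 : A⁻¹ = ((2 * Real.pi)^(n/2))⁻¹ * (l^2)^(n/2) := by
    rw [hA, Real.div_rpow (by positivity) (by positivity), inv_div]; field_simp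
  have e2 : (l^2/4)^(-(s/2)) = (l^2)^(-(s/2)) * (1/4)^(-(s/2)) := by
    rw [div_eq_mul_one_div, Real.mul_rpow hl2.le (by norm_num)]
  have e3 : (2 * l^2)^(-(s/2)) = 2^(-(s/2)) * (l^2)^(-(s/2)) := 
    Real.mul_rpow (by norm_num) hl2.le
  have e4 : (l^2)^(n/2 - s) = (l^2)^(n/2) * (l^2)^(-(s/2)) * (l^2)^(-(s/2)) := by
    rw [← Real.rpow_add hl2, ← Real.rpow_add hl2]; congr 1; ring
  rw [e1, e2, e3, e4]
  ring

end FourierPart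


/-- The Fourier integral of the characteristic function, with a Gaussian regularisation. -/
lemma charFun_gauss (ν : Measure ℝ) [IsFiniteMeasure ν] (b : ℝ) (hb : 0 < b) (t : ℝ) :
    ∫ ξ : ℝ, (Real.exp (-(b * ‖ξ‖ ^ 2)) : ℂ) * (Complex.exp (Complex.I * ((-(ξ * t) : ℝ) : ℂ)) * charFun ν ξ) =
      ∫ u, (((Real.pi / b) ^ ((1 : ℝ) / 2) * Real.exp (-(‖u - t‖ ^ 2 / (4 * b))) : ℝ) : ℂ) ∂ν := by
  have hg : Integrable (fun z : ℝ => ((Real.exp (-(b * ‖z‖^2)) : ℝ) : ℂ)) := by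
    have := (gauss_integrable b hb (0 : ℝ)).ofReal (𝕜 := ℂ)
    simpa using this
  have hInt : Integrable (Function.uncurry fun (ξ u : ℝ) => (Real.exp (-(b * ‖ξ‖ ^ 2)) : ℂ) *
      Complex.exp (Complex.I * (inner ℝ ξ (u - t) : ℝ))) (volume.prod ν) := by
    have i1 : Integrable (fun q : ℝ × ℝ => ((Real.exp (-(b * ‖q.1‖ ^ 2)) : ℝ) : ℂ) * (1 : ℂ))
      (volume.prod ν) := hg.mul_prod (integrable_const (μ := ν) (1:ℂ))
    refine (i1.bdd_mul (c := 1) (f := fun q : ℝ × ℝ => Complex.exp (Complex.I * (inner ℝ q.1 (q.2 - t) : ℝ)))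
      (Continuous.aestronglyMeasurable (by fun_prop)) (Filter.Eventually.of_forall fun q => ?_)).congr
      (Filter.Eventually.of_forall fun q => ?_)
    · rw [norm_cexp_I]
    · simp only [Function.uncurry]; ring
  calc _ = ∫ ξ : ℝ, ∫ u, (Real.exp (-(b * ‖ξ‖ ^ 2)) : ℂ) *
      Complex.exp (Complex.I * (inner ℝ ξ (u - t) : ℝ)) ∂ν := by
        refine integral_congr_ae (Filter.Eventually.of_forall fun ξ => ?_)
        simp only
        rw [charFun_apply_real, ← integral_const_mul, ← integral_const_mul]
        refine integral_congr_ae (Filter.Eventually.of_forall fun u => ?_)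
        simp only
        rw [← Complex.exp_add]
        congr 2
        simp
        ring
    _ = ∫ u, (∫ ξ : ℝ, (Real.exp (-(b * ‖ξ‖ ^ 2)) : ℂ) *
      Complex.exp (Complex.I * (inner ℝ ξ (u - t) : ℝ))) ∂ν := integral_integral_swap hInt
    _ = _ := by
        refine integral_congr_ae (Filter.Eventually.of_forall fun u => ?_)
        simp only
        rw [gauss_ft b hb (u - t)]
        simp

lemma charFun_int_zero (ν : Measure ℝ) [IsFiniteMeasure ν] (A : Set ℝ) (hA : IsClosed A)
    (hνA : ν Aᶜ = 0) (hN : Integrable (charFun ν)) (t : ℝ) (ht : t ∉ A) :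
    ∫ ξ : ℝ, Complex.exp (Complex.I * ((-(ξ * t) : ℝ) : ℂ)) * charFun ν ξ = 0 := by
  obtain ⟨δ, hδ, hball⟩ := Metric.isOpen_iff.1 hA.isOpen_compl t ht
  have h1 : Filter.Tendsto (fun b : ℝ => ∫ ξ : ℝ, (Real.exp (-(b * ‖ξ‖ ^ 2)) : ℂ) * 
      (Complex.exp (Complex.I * ((-(ξ * t) : ℝ) : ℂ)) * charFun ν ξ)) (nhdsWithin 0 (Set.Ioi 0))
      (nhds (∫ ξ : ℝ, Complex.exp (Complex.I * ((-(ξ * t) : ℝ) : ℂ)) * charFun ν ξ)) := by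
    refine tendsto_integral_filter_of_dominated_convergence (fun ξ => ‖charFun ν ξ‖) ?_ ?_ hN.norm ?_
    · refine Filter.Eventually.of_forall fun b => ?_
      have := continuous_charFun (μ := ν)
      exact Continuous.aestronglyMeasurable (by fun_prop)
    · filter_upwards [self_mem_nhdsWithin] with b hb
      refine Filter.Eventually.of_forall fun ξ => ?_
      have hb : 0 < b := hb
      rw [norm_mul, norm_mul, norm_cexp_I, one_mul, Complex.norm_real, Real.norm_eq_abs, Real.abs_exp]
      refine mul_le_of_le_one_left (norm_nonneg _) (Real.exp_le_one_iff.2 ?_)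
      have : 0 ≤ b * ‖ξ‖^2 := by positivity
      linarith
    · refine Filter.Eventually.of_forall fun ξ => ?_
      have hc : Continuous (fun b : ℝ => (Real.exp (-(b * ‖ξ‖ ^ 2)) : ℂ) * 
        (Complex.exp (Complex.I * ((-(ξ * t) : ℝ) : ℂ)) * charFun ν ξ)) := by fun_prop
      have := (hc.tendsto 0).mono_left (nhdsWithin_le_nhds (s := Set.Ioi 0))
      simpa using this
  have h2 : Filter.Tendsto (fun b : ℝ => ∫ ξ : ℝ, (Real.exp (-(b * ‖ξ‖ ^ 2)) : ℂ) * 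
      (Complex.exp (Complex.I * ((-(ξ * t) : ℝ) : ℂ)) * charFun ν ξ)) (nhdsWithin 0 (Set.Ioi 0))
      (nhds 0) := by
    have hc : Continuous (fun b : ℝ => (Real.pi * b)^((1:ℝ)/2) * 4 / δ^2 * ν.real Set.univ) := by
      have : Continuous (fun b : ℝ => (Real.pi * b)^((1:ℝ)/2)) := 
        (continuous_const.mul continuous_id).rpow_const (fun x => Or.inr (by norm_num))
      fun_prop
    have ht0 := (hc.tendsto 0).mono_left (nhdsWithin_le_nhds (s := Set.Ioi 0))
    rw [mul_zero, Real.zero_rpow (by norm_num), zero_mul, zero_div, zero_mul] at ht0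
    refine squeeze_zero_norm' ?_ ht0
    filter_upwards [self_mem_nhdsWithin] with b hb
    have hb : 0 < b := hb
    rw [charFun_gauss ν b hb t]
    refine norm_integral_le_of_norm_le_const ?_
    have hae : ∀ᵐ u ∂ν, u ∈ A := by rw [ae_iff]; exact hνA
    filter_upwards [hae] with u hu
    rw [Complex.norm_real, Real.norm_eq_abs, abs_of_nonneg (by positivity)]
    have hd : δ ≤ ‖u - t‖ := by
      by_contra hlt
      push Not at hlt
      exact hball (by rwa [Metric.mem_ball, dist_eq_norm]) hu
    have hx : 0 < ‖u - t‖^2 / (4 * b) := by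
      have : 0 < ‖u - t‖ := hδ.trans_le hd
      positivity
    have h3 : Real.exp (-(‖u - t‖ ^ 2 / (4 * b))) ≤ 4 * b / δ^2 := by
      rw [Real.exp_neg]
      calc _ ≤ (‖u - t‖^2 / (4 * b))⁻¹ := by
            gcongr
            have := Real.add_one_le_exp (‖u - t‖^2 / (4 * b))
            linarith
        _ = 4 * b / ‖u - t‖^2 := inv_div _ _
        _ ≤ _ := by gcongr
    calc _ ≤ (Real.pi / b) ^ ((1:ℝ)/2) * (4 * b / δ^2) := by gcongr
      _ = _ := by
        rw [← Real.sqrt_eq_rpow, ← Real.sqrt_eq_rpow, Real.sqrt_div Real.pi_pos.le, Real.sqrt_mul Real.pi_pos.le]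
        have : Real.sqrt b * Real.sqrt b = b := Real.mul_self_sqrt hb.le
        have hs : 0 < Real.sqrt b := Real.sqrt_pos.2 hb
        field_simp
        rw [sq, this]
  exact tendsto_nhds_unique h1 h2

lemma interior_of_charFun (ν : Measure ℝ) [IsFiniteMeasure ν] (A : Set ℝ) (hA : IsClosed A)
    (hνA : ν Aᶜ = 0) (hν : ν ≠ 0) (hN : Integrable (charFun ν)) : (interior A).Nonempty := by
  by_contra hne
  rw [Set.not_nonempty_iff_eq_empty] at hne
  have hdense : Dense Aᶜ := interior_eq_empty_iff_dense_compl.1 hne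
  let h : ℝ → ℂ := fun t => ∫ ξ : ℝ, Complex.exp (Complex.I * ((-(ξ * t) : ℝ) : ℂ)) * charFun ν ξ
  have hcont : Continuous h := by
    refine continuous_of_dominated (bound := fun ξ => ‖charFun ν ξ‖) ?_ ?_ hN.norm ?_
    · intro t
      have := continuous_charFun (μ := ν)
      exact Continuous.aestronglyMeasurable (by fun_prop)
    · intro t
      refine Filter.Eventually.of_forall fun ξ => ?_
      rw [norm_mul, norm_cexp_I, one_mul]
    · refine Filter.Eventually.of_forall fun ξ => ?_
      fun_prop
  have h0 : h = fun _ => 0 := hcont.ext_on hdense continuous_const 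
    (fun t ht => charFun_int_zero ν A hA hνA hN t ht)
  have hF : FourierTransform.fourier (charFun ν) = (fun _ => 0 : ℝ → ℂ) := by
    funext w
    rw [Real.fourier_real_eq_integral_exp_smul]
    have := congrFun h0 (2 * Real.pi * w)
    simp only [h] at this
    rw [← this]
    refine integral_congr_ae (Filter.Eventually.of_forall fun ξ => ?_)
    simp only [smul_eq_mul]
    congr 2
    push_cast
    ring
  have hinv := Continuous.fourierInv_fourier_eq (continuous_charFun (μ := ν)) hN 
    (by rw [hF]; exact integrable_zero _ _ _)
  have h1 := congrFun hinv 0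
  rw [hF, Real.fourierInv_eq] at h1
  simp only [smul_zero, integral_zero, charFun_zero] at h1
  have h2 : ν.real Set.univ = 0 := by exact_mod_cast h1.symm
  rw [measureReal_eq_zero_iff] at h2
  exact hν (Measure.measure_univ_eq_zero.1 h2)

set_option linter.unusedSectionVars false

section ConfigPart

variable {V : Type*} [NormedAddCommGroup V] [InnerProductSpace ℝ V] [FiniteDimensional ℝ V]
  [MeasurableSpace V] [BorelSpace V]

/-- The truncated phase used to write the inner integrals as Fourier transforms. -/
noncomputable def phaseFn (B : Set V) (R ξ : ℝ) : V → ℂ :=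
  (B ∩ Metric.closedBall 0 R).indicator (fun y => Complex.exp (Complex.I * ((ξ * ‖y‖^2 : ℝ) : ℂ)))

lemma inner_phase (μ : Measure V) (R : ℝ) (hR : ∀ᵐ x ∂μ, ‖x‖ ≤ R) (B : Set V) (hB : MeasurableSet B)
    (ξ : ℝ) (x : V) :
    ‖∫ y in B, Complex.exp (Complex.I * ((ξ * ‖x - y‖^2 : ℝ) : ℂ)) ∂μ‖ =
      ‖FTm μ (phaseFn B R ξ) (-2 * ξ) x‖ := by
  have e : ∫ y in B, Complex.exp (Complex.I * ((ξ * ‖x - y‖^2 : ℝ) : ℂ)) ∂μ =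
      Complex.exp (Complex.I * ((ξ * ‖x‖^2 : ℝ) : ℂ)) * FTm μ (phaseFn B R ξ) (-2 * ξ) x := by
    rw [FTm, ← integral_const_mul, ← integral_indicator hB]
    refine integral_congr_ae ?_
    filter_upwards [hR] with y hy
    by_cases hyB : y ∈ B
    · have : y ∈ B ∩ Metric.closedBall 0 R := ⟨hyB, by simpa using hy⟩
      rw [phaseFn, Set.indicator_of_mem hyB, Set.indicator_of_mem this, ← Complex.exp_add, 
        ← Complex.exp_add, norm_sub_sq_real, inner_smul_right]
      congr 1
      push_cast
      ring
    · have : y ∉ B ∩ Metric.closedBall 0 R := fun h => hyB h.1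
      rw [phaseFn, Set.indicator_of_notMem hyB, Set.indicator_of_notMem this]
      simp
  rw [e, norm_mul, norm_cexp_I, one_mul]

lemma phaseFn_measurable (B : Set V) (hB : MeasurableSet B) (R ξ : ℝ) : Measurable (phaseFn B R ξ) := by
  refine Measurable.indicator ?_ (hB.inter Metric.isClosed_closedBall.measurableSet)
  fun_prop

lemma phaseFn_norm_le (B : Set V) (R ξ : ℝ) (y : V) : ‖phaseFn B R ξ y‖ ≤ 1 := by
  rw [phaseFn]
  refine (norm_indicator_le_norm_self _ _).trans ?_
  rw [norm_cexp_I]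

lemma phaseFn_zero (B : Set V) (R ξ : ℝ) (y : V) (hy : R < ‖y‖) : phaseFn B R ξ y = 0 := by
  rw [phaseFn, Set.indicator_of_notMem]
  rintro ⟨-, h⟩
  rw [mem_closedBall_zero_iff] at h
  linarith

/-- The measure on squared configurations. -/
noncomputable def confMeas (μ : Measure V) (B₁ B₂ : Set V) (h : V → ℝ) : Measure ℝ :=
  (μ.prod ((μ.restrict B₁).prod (μ.restrict B₂))).map
    (fun q => ‖q.1 - q.2.1‖^2 + ‖q.1 - q.2.2‖^2 + h q.1)

lemma confMeas_charFun_le (μ : Measure V) [IsProbabilityMeasure μ] (B₁ B₂ : Set V) 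
    (hB₁ : MeasurableSet B₁) (hB₂ : MeasurableSet B₂) (h : V → ℝ) (hh : Continuous h)
    (R : ℝ) (hR : ∀ᵐ x ∂μ, ‖x‖ ≤ R) (ξ : ℝ) :
    ‖charFun (confMeas μ B₁ B₂ h) ξ‖ ≤ 
      ((∫ x, ‖FTm μ (phaseFn B₁ R ξ) (-2 * ξ) x‖^2 ∂μ) +
       (∫ x, ‖FTm μ (phaseFn B₂ R ξ) (-2 * ξ) x‖^2 ∂μ)) / 2 := by
  have hi : ∀ B, MeasurableSet B → Integrable (fun x => ‖FTm μ (phaseFn B R ξ) (-2 * ξ) x‖^2) μ := by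
    intro B hB
    have hcf := FTm_continuous μ _ (phaseFn_measurable B hB R ξ) 1 (phaseFn_norm_le B R ξ) (-2 * ξ)
    have hbf := FTm_norm_le μ _ 1 (phaseFn_norm_le B R ξ) (-2 * ξ)
    refine Integrable.of_bound (hcf.norm.pow 2).aestronglyMeasurable 1 
      (Filter.Eventually.of_forall fun x => ?_)
    change ‖‖FTm μ (phaseFn B R ξ) (-2 * ξ) x‖ ^ 2‖ ≤ 1
    rw [norm_pow, norm_norm]; exact pow_le_one₀ (norm_nonneg _) (hbf x)
  rw [charFun_apply_real, confMeas, integral_map (Continuous.aemeasurable (by fun_prop)) 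
    (Continuous.aestronglyMeasurable (by fun_prop)), integral_prod]
  swap
  · refine Integrable.of_bound (Continuous.aestronglyMeasurable (by fun_prop)) 1 
      (Filter.Eventually.of_forall fun q => ?_)
    rw [← Complex.ofReal_mul, mul_comm, norm_cexp_I]
  rw [← integral_add (hi B₁ hB₁) (hi B₂ hB₂), ← integral_div]
  refine norm_integral_le_of_norm_le (((hi B₁ hB₁).add (hi B₂ hB₂)).div_const 2) 
    (Filter.Eventually.of_forall fun x => ?_)
  have e : ∀ q : V × V, Complex.exp ((ξ : ℂ) * ((‖x - q.1‖^2 + ‖x - q.2‖^2 + h x : ℝ) : ℂ) * Complex.I) = 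
      Complex.exp (Complex.I * ((ξ * h x : ℝ) : ℂ)) * 
      (Complex.exp (Complex.I * ((ξ * ‖x - q.1‖^2 : ℝ) : ℂ)) * 
       Complex.exp (Complex.I * ((ξ * ‖x - q.2‖^2 : ℝ) : ℂ))) := by
    intro q
    rw [← Complex.exp_add, ← Complex.exp_add]
    congr 1
    push_cast
    ring
  simp only [e]
  rw [integral_const_mul, norm_mul, norm_cexp_I, one_mul, 
    integral_prod_mul (fun y => Complex.exp (Complex.I * ((ξ * ‖x - y‖^2 : ℝ) : ℂ)))
      (fun y => Complex.exp (Complex.I * ((ξ * ‖x - y‖^2 : ℝ) : ℂ))), norm_mul, 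
    inner_phase μ R hR B₁ hB₁, inner_phase μ R hR B₂ hB₂]
  nlinarith [sq_nonneg (‖FTm μ (phaseFn B₁ R ξ) (-2 * ξ) x‖ - ‖FTm μ (phaseFn B₂ R ξ) (-2 * ξ) x‖)]

instance confMeas_finite (μ : Measure V) [IsProbabilityMeasure μ] (B₁ B₂ : Set V) (h : V → ℝ) :
    IsFiniteMeasure (confMeas μ B₁ B₂ h) := by
  unfold confMeas; infer_instance

lemma confMeas_charFun_integrable (μ : Measure V) [IsProbabilityMeasure μ] (B₁ B₂ : Set V) 
    (hB₁ : MeasurableSet B₁) (hB₂ : MeasurableSet B₂) (h : V → ℝ) (hh : Continuous h)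
    (s C R : ℝ) (hs : ((Module.finrank ℝ V : ℝ) + 1) / 2 < s)
    (hG : ∀ a : ℝ, 0 < a → ∀ z : V, ∫ x, Real.exp (-(a * dist x z ^ 2)) ∂μ ≤ C * a ^ (-(s/2)))
    (hR : ∀ᵐ x ∂μ, ‖x‖ ≤ R) (hR0 : 0 ≤ R) :
    Integrable (charFun (confMeas μ B₁ B₂ h)) := by
  obtain ⟨K, hK⟩ := FTm_L2 μ s C R hG hR hR0
  set ν := confMeas μ B₁ B₂ h with hν
  set r : ℝ := 2 * s - Module.finrank ℝ V with hr
  have hr1 : 1 < r := by rw [hr]; linarith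
  have hInt : Integrable (fun ξ : ℝ => (1 + ‖ξ‖^2) ^ (-r/2)) := 
    integrable_rpow_neg_one_add_norm_sq (by simpa using hr1)
  set M := |K| * (4/5 : ℝ)^(-r/2) + ν.real Set.univ * (5/4 : ℝ)^(r/2) with hM
  refine (hInt.const_mul M).mono' (continuous_charFun (μ := ν)).aestronglyMeasurable 
    (Filter.Eventually.of_forall fun ξ => ?_)
  rw [Real.norm_eq_abs, sq_abs]
  have hp : 0 < (1 + ξ^2 : ℝ) ^ (-r/2) := by positivity
  by_cases hξ : 1 ≤ (-2 * ξ)^2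
  · have a1 := hK _ (phaseFn_measurable B₁ hB₁ R ξ) (phaseFn_norm_le B₁ R ξ) (phaseFn_zero B₁ R ξ) _ hξ
    have a2 := hK _ (phaseFn_measurable B₂ hB₂ R ξ) (phaseFn_norm_le B₂ R ξ) (phaseFn_zero B₂ R ξ) _ hξ
    have a3 := confMeas_charFun_le μ B₁ B₂ hB₁ hB₂ h hh R hR ξ
    have a4 : ‖charFun ν ξ‖ ≤ K * ((-2 * ξ)^2) ^ ((Module.finrank ℝ V : ℝ)/2 - s) := by linarith
    have e : (Module.finrank ℝ V : ℝ)/2 - s = -r/2 := by rw [hr]; ring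
    rw [e] at a4
    calc _ ≤ |K| * ((-2 * ξ)^2) ^ (-r/2) := a4.trans (by gcongr; exact le_abs_self K)
      _ ≤ |K| * (4/5 * (1 + ξ^2)) ^ (-r/2) := by
        exact mul_le_mul_of_nonneg_left
          (Real.rpow_le_rpow_of_nonpos (by positivity) (by nlinarith) (by linarith)) (abs_nonneg K)
      _ = |K| * (4/5 : ℝ)^(-r/2) * (1 + ξ^2) ^ (-r/2) := by
        rw [Real.mul_rpow (by norm_num) (by positivity), mul_assoc]
      _ ≤ _ := by
        gcongr
        rw [hM]
        have : 0 ≤ ν.real Set.univ * (5/4 : ℝ)^(r/2) := by positivity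
        linarith
  · push Not at hξ
    have b1 : (1 : ℝ) ≤ (5/4 : ℝ)^(r/2) * (1 + ξ^2) ^ (-r/2) := by
      have : ((5/4 : ℝ))^(-r/2) ≤ (1 + ξ^2) ^ (-r/2) := 
        Real.rpow_le_rpow_of_nonpos (by positivity) (by nlinarith) (by linarith)
      calc (1:ℝ) = (5/4 : ℝ)^(r/2) * (5/4 : ℝ)^(-r/2) := by
            rw [← Real.rpow_add (by norm_num)]; ring_nf; simp
        _ ≤ _ := by gcongr
    calc _ ≤ ν.real Set.univ := norm_charFun_le ξ
      _ ≤ ν.real Set.univ * ((5/4 : ℝ)^(r/2) * (1 + ξ^2) ^ (-r/2)) := 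
        le_mul_of_one_le_right (by positivity) b1
      _ = ν.real Set.univ * (5/4 : ℝ)^(r/2) * (1 + ξ^2) ^ (-r/2) := by ring
      _ ≤ _ := by
        gcongr
        rw [hM]
        have : 0 ≤ |K| * (4/5 : ℝ)^(-r/2) := by positivity
        linarith

end ConfigPart

section Assembly

variable {V : Type*} [NormedAddCommGroup V] [InnerProductSpace ℝ V] [FiniteDimensional ℝ V]
  [MeasurableSpace V] [BorelSpace V]

lemma gauss_noAtoms (μ : Measure V) [IsProbabilityMeasure μ] (s C : ℝ) (hs : 0 < s)
    (hG : ∀ a : ℝ, 0 < a → ∀ z : V, ∫ x, Real.exp (-(a * dist x z ^ 2)) ∂μ ≤ C * a ^ (-(s/2))) 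
    (z : V) : μ {z} = 0 := by
  have h1 : ∀ a : ℝ, 0 < a → μ.real {z} ≤ C * a ^ (-(s/2)) := by
    intro a ha
    refine le_trans ?_ (hG a ha z)
    rw [← integral_indicator_one (measurableSet_singleton z)]
    refine integral_mono ((integrable_const (1:ℝ)).indicator (measurableSet_singleton z)) ?_ fun x => ?_
    · refine Integrable.of_bound (Measurable.aestronglyMeasurable (by fun_prop)) 1 
        (Filter.Eventually.of_forall fun x => ?_)
      rw [Real.norm_eq_abs, Real.abs_exp, Real.exp_le_one_iff]
      have : 0 ≤ a * dist x z ^2 := by positivity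
      linarith
    · by_cases hx : x = z
      · subst hx; simp
      · rw [Set.indicator_of_notMem (by simpa using hx)]
        positivity
  have h2 : Filter.Tendsto (fun a : ℝ => C * a ^ (-(s/2))) Filter.atTop (nhds 0) := by
    have := (tendsto_rpow_neg_atTop (half_pos hs)).const_mul C
    simpa using this
  have h3 : μ.real {z} ≤ 0 := ge_of_tendsto h2 (by
    filter_upwards [Filter.eventually_gt_atTop 0] with a ha using h1 a ha)
  rw [← measureReal_eq_zero_iff (μ := μ)]
  exact le_antisymm h3 measureReal_nonneg

lemma config_interior (E : Set V) (hE : IsCompact E) (s ε : ℝ) 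
    (hs : ((Module.finrank ℝ V : ℝ) + 1) / 2 < s) (hε : 0 < ε) 
    (hH : Measure.hausdorffMeasure (s + ε) E ≠ 0) (m : ℕ) :
    (interior { t : ℝ | ∃ (x : V) (y : Fin (m + 2) → V), x ∈ E ∧ (∀ i, y i ∈ E) ∧ 
      (∀ i j, i ≠ j → y i ≠ y j) ∧ t = Real.sqrt (∑ i, ‖x - y i‖ ^ 2) }).Nonempty := by
  have hs0 : 0 < s := lt_of_le_of_lt (by positivity) hs
  obtain ⟨μ, hμ, hμE, C, hG⟩ := frostman_gauss E hE s ε hs0 hε hH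
  have hat : ∀ z, μ {z} = 0 := gauss_noAtoms μ s C hs0 hG
  have hfin : ∀ T : Set V, T.Finite → μ T = 0 := by
    intro T hT
    haveI : NullSingletonClass μ := ⟨hat⟩
    exact hT.measure_zero μ
  have hE1 : μ E = 1 := by
    rw [← prob_compl_eq_zero_iff hE.measurableSet]; exact hμE
  have hdiff : ∀ T : Set V, T.Finite → μ (E \ T) ≠ 0 := by
    intro T hT
    rw [measure_sdiff_null (hfin T hT), hE1]
    exact one_ne_zero
  have hEinf : E.Infinite := by
    intro hf
    have := hfin E hf
    rw [hE1] at this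
    exact one_ne_zero this
  -- the frozen points
  let q : Fin m → V := fun i => (hEinf.natEmbedding E i : V)
  have hqE : ∀ i, q i ∈ E := fun i => (hEinf.natEmbedding E i).2
  have hqinj : Function.Injective q := by
    intro i j hij
    exact Fin.ext ((hEinf.natEmbedding E).injective (Subtype.ext hij))
  have hQ : (Set.range q).Finite := Set.finite_range q
  obtain ⟨p₂, hp₂, hp₂'⟩ := exists_mem_forall_mem_nhdsWithin_pos_measure (hdiff _ hQ)
  obtain ⟨p₁, hp₁, hp₁'⟩ := exists_mem_forall_mem_nhdsWithin_pos_measure (hdiff _ (hQ.insert p₂))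
  obtain ⟨δ₂, hδ₂, hb₂⟩ := Metric.isOpen_iff.1 hQ.isClosed.isOpen_compl p₂ hp₂.2
  obtain ⟨δ₁, hδ₁, hb₁⟩ := Metric.isOpen_iff.1 (hQ.insert p₂).isClosed.isOpen_compl p₁ hp₁.2
  set r := min (δ₁/3) (δ₂/3) with hr
  have hr0 : 0 < r := by positivity
  have hr1 : r ≤ δ₁/3 := min_le_left _ _
  have hr2 : r ≤ δ₂/3 := min_le_right _ _
  set B₁ := Metric.closedBall p₁ r with hB₁
  set B₂ := Metric.closedBall p₂ r with hB₂
  have hμ₁ : 0 < μ B₁ := hp₁' _ (nhdsWithin_le_nhds (Metric.closedBall_mem_nhds _ hr0))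
  have hμ₂ : 0 < μ B₂ := hp₂' _ (nhdsWithin_le_nhds (Metric.closedBall_mem_nhds _ hr0))
  have hq₁ : ∀ y ∈ B₁, y ∉ Set.range q := by
    intro y hy hyq
    have : y ∈ Metric.ball p₁ δ₁ := by
      rw [Metric.mem_closedBall] at hy; rw [Metric.mem_ball]; linarith
    exact hb₁ this (Set.mem_insert_of_mem _ hyq)
  have hq₂ : ∀ y ∈ B₂, y ∉ Set.range q := by
    intro y hy hyq
    have : y ∈ Metric.ball p₂ δ₂ := by
      rw [Metric.mem_closedBall] at hy; rw [Metric.mem_ball]; linarith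
    exact hb₂ this hyq
  have hdisj : ∀ y₁ ∈ B₁, ∀ y₂ ∈ B₂, y₁ ≠ y₂ := by
    rintro y h1 _ h2 rfl
    rw [Metric.mem_closedBall] at h1 h2
    have h3 : dist p₂ p₁ ≤ dist p₂ y + dist y p₁ := dist_triangle _ _ _
    rw [dist_comm p₂ y] at h3
    have : p₂ ∈ Metric.ball p₁ δ₁ := by rw [Metric.mem_ball]; linarith
    exact hb₁ this (Set.mem_insert _ _)
  let h : V → ℝ := fun x => ∑ i, ‖x - q i‖^2
  have hh : Continuous h := by fun_prop
  obtain ⟨R, hR⟩ := hE.isBounded.exists_norm_le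
  have haeE : ∀ᵐ x ∂μ, x ∈ E := by rw [ae_iff]; exact hμE
  have hRae : ∀ᵐ x ∂μ, ‖x‖ ≤ R := by filter_upwards [haeE] with x hx using hR x hx
  have hR0 : 0 ≤ R := by
    obtain ⟨x, hx⟩ := hEinf.nonempty
    exact (norm_nonneg x).trans (hR x hx)
  have hB₁m : MeasurableSet B₁ := Metric.isClosed_closedBall.measurableSet
  have hB₂m : MeasurableSet B₂ := Metric.isClosed_closedBall.measurableSet
  have hInt := confMeas_charFun_integrable μ B₁ B₂ hB₁m hB₂m h hh s C R hs hG hRae hR0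
  let φ : V × V × V → ℝ := fun q => ‖q.1 - q.2.1‖^2 + ‖q.1 - q.2.2‖^2 + h q.1
  have hφ : Continuous φ := by fun_prop
  have hφdef : ∀ x y z, φ (x, y, z) = ‖x - y‖^2 + ‖x - z‖^2 + h x := fun _ _ _ => rfl
  let P : Set (V × V × V) := E ×ˢ ((E ∩ B₁) ×ˢ (E ∩ B₂))
  have hP : IsCompact P := hE.prod ((hE.inter_right Metric.isClosed_closedBall).prod 
    (hE.inter_right Metric.isClosed_closedBall))
  let A : Set ℝ := φ '' P
  have hA : IsClosed A := (hP.image hφ).isClosed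
  have hPae : ∀ᵐ w ∂(μ.prod ((μ.restrict B₁).prod (μ.restrict B₂))), w ∈ P := by
    have a1 : ∀ᵐ y ∂(μ.restrict B₁), y ∈ E ∩ B₁ := by
      filter_upwards [ae_restrict_of_ae haeE, ae_restrict_mem hB₁m] with y h1 h2 using ⟨h1, h2⟩
    have a2 : ∀ᵐ y ∂(μ.restrict B₂), y ∈ E ∩ B₂ := by
      filter_upwards [ae_restrict_of_ae haeE, ae_restrict_mem hB₂m] with y h1 h2 using ⟨h1, h2⟩
    have b1 : ∀ᵐ z ∂((μ.restrict B₁).prod (μ.restrict B₂)), z ∈ (E ∩ B₁) ×ˢ (E ∩ B₂) := by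
      filter_upwards [Measure.quasiMeasurePreserving_fst.ae a1, 
        Measure.quasiMeasurePreserving_snd.ae a2] with z h1 h2 using ⟨h1, h2⟩
    filter_upwards [Measure.quasiMeasurePreserving_fst.ae haeE, 
        Measure.quasiMeasurePreserving_snd.ae b1] with z h1 h2 using ⟨h1, h2⟩
  have hνA : confMeas μ B₁ B₂ h Aᶜ = 0 := by
    have : confMeas μ B₁ B₂ h = (μ.prod ((μ.restrict B₁).prod (μ.restrict B₂))).map φ := rfl
    rw [this, Measure.map_apply hφ.measurable hA.measurableSet.compl]
    rw [ae_iff] at hPae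
    refine measure_mono_null ?_ hPae
    intro w hw hwP
    exact hw ⟨w, hwP, rfl⟩
  have hν : confMeas μ B₁ B₂ h ≠ 0 := by
    intro h0
    have h1 := congrArg (fun ν : Measure ℝ => ν Set.univ) h0
    have : confMeas μ B₁ B₂ h = (μ.prod ((μ.restrict B₁).prod (μ.restrict B₂))).map φ := rfl
    simp only [this, Measure.map_apply hφ.measurable MeasurableSet.univ, Set.preimage_univ,
      Measure.coe_zero, Pi.zero_apply] at h1
    rw [← Set.univ_prod_univ, Measure.prod_prod, ← Set.univ_prod_univ, Measure.prod_prod, 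
      Measure.restrict_apply_univ, Measure.restrict_apply_univ, measure_univ, one_mul] at h1
    exact (mul_ne_zero hμ₁.ne' hμ₂.ne') h1
  obtain ⟨c, hc⟩ := interior_of_charFun _ A hA hνA hν hInt
  have hAnn : ∀ a ∈ A, 0 ≤ a := by
    rintro _ ⟨w, -, rfl⟩
    simp only [φ, h]
    positivity
  obtain ⟨η, hη, hηA⟩ := Metric.isOpen_iff.1 isOpen_interior c hc
  have hc0 : 0 ≤ c := hAnn c (interior_subset hc)
  have hcη : c + η/2 ∈ interior A := hηA (by rw [Metric.mem_ball, Real.dist_eq]; simp; rw [abs_of_pos (by linarith)]; linarith)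
  refine ⟨Real.sqrt (c + η/2), mem_interior.2 ⟨{t | 0 < t} ∩ {t | t^2 ∈ interior A}, ?_, ?_, ?_⟩⟩
  · rintro t ⟨ht0, htA⟩
    have ht0 : 0 < t := ht0
    obtain ⟨⟨x, y₁, y₂⟩, ⟨hx, ⟨hy₁, hy₁B⟩, ⟨hy₂, hy₂B⟩⟩, hφt⟩ := interior_subset htA
    simp only at hx hy₁ hy₁B hy₂ hy₂B
    refine ⟨x, Fin.cons y₁ (Fin.cons y₂ q : Fin (m+1) → V), hx, ?_, ?_, ?_⟩
    · intro i
      refine Fin.cases ?_ (fun i => ?_) i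
      · simpa using hy₁
      · refine Fin.cases ?_ (fun i => ?_) i
        · simpa using hy₂
        · simpa using hqE i
    · have hinj : Function.Injective (Fin.cons y₁ (Fin.cons y₂ q : Fin (m+1) → V) : Fin (m+2) → V) := by
        rw [Fin.cons_injective_iff, Fin.cons_injective_iff]
        refine ⟨?_, hq₂ _ hy₂B, hqinj⟩
        rw [Fin.range_cons]
        rintro (h1 | h1)
        · exact hdisj _ hy₁B _ hy₂B h1
        · exact hq₁ _ hy₁B h1
      exact fun i j hij h => hij (hinj h)
    · rw [Fin.sum_univ_succ, Fin.sum_univ_succ]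
      simp only [Fin.cons_zero, Fin.cons_succ]
      rw [hφdef] at hφt
      rw [← add_assoc]
      change t = Real.sqrt (‖x - y₁‖^2 + ‖x - y₂‖^2 + h x)
      rw [hφt, Real.sqrt_sq ht0.le]
  · exact (isOpen_lt continuous_const continuous_id).inter (isOpen_interior.preimage (by fun_prop))
  · refine ⟨Real.sqrt_pos.2 (by linarith), ?_⟩
    change Real.sqrt (c + η/2) ^ 2 ∈ interior A
    rw [Real.sq_sqrt (by linarith)]
    exact hcη

end Assembly

/-- For compact `E ⊆ ℝ^d` (`d ≥ 2`) and `k ≥ 3`, if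
`dim E > ((k−1)d + 1)/k`, then the `k`-point diagonal configuration set
`Δ°ₖ^diag(E) = { |(x,…,x) − (y₁,…,y_{k−1})| : x, yᵢ ∈ E, yᵢ ≠ yⱼ for i ≠ j }`
(Euclidean norm on `ℝ^{(k−1)d}`) has nonempty interior in `ℝ`. -/
theorem stmt_3 (d k : ℕ) (hd : 2 ≤ d) (hk : 3 ≤ k) (E : Set (EuclideanSpace ℝ (Fin d)))
    (hE : IsCompact E)
    (hdim : (((k - 1) * d + 1 : ℕ) : ℝ≥0∞) / k < dimH E) :
    (interior { t : ℝ |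
      ∃ (x : EuclideanSpace ℝ (Fin d)) (y : Fin (k - 1) → EuclideanSpace ℝ (Fin d)),
        x ∈ E ∧ (∀ i, y i ∈ E) ∧ (∀ i j, i ≠ j → y i ≠ y j) ∧
        t = Real.sqrt (∑ i, ‖x - y i‖ ^ 2) }).Nonempty := by
  obtain ⟨m, rfl⟩ : ∃ m, k = m + 3 := ⟨k - 3, by omega⟩
  obtain ⟨s₁, h1, h2⟩ := ENNReal.lt_iff_exists_nnreal_btwn.1 hdim
  have h3 : ((((m + 2) * d + 1 : ℕ) : ℝ)) < s₁ * ((m + 3 : ℕ) : ℝ) := by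
    rw [ENNReal.div_lt_iff (Or.inl (by simp)) (Or.inl (by simp))] at h1
    have h4 : ((((m + 2) * d + 1 : ℕ) : NNReal)) < s₁ * ((m + 3 : ℕ) : NNReal) := by
      rw [← ENNReal.coe_lt_coe]
      push_cast at h1 ⊢
      exact h1
    exact_mod_cast h4
  have hlt : ((d : ℝ) + 1) / 2 < s₁ := by
    push_cast at h3
    have hd' : (2:ℝ) ≤ d := by exact_mod_cast hd
    have hm : (0:ℝ) ≤ m := by positivity
    have : ((d : ℝ) + 1) / 2 * (m + 3) ≤ (m + 2) * d + 1 := by nlinarith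
    exact lt_of_mul_lt_mul_right (this.trans_lt h3) (by positivity)
  have hH : Measure.hausdorffMeasure ((s₁ : ℝ)) E ≠ 0 := by
    rw [hausdorffMeasure_of_lt_dimH h2]; simp
  refine config_interior E hE ((s₁ + ((d : ℝ) + 1) / 2)/2) (s₁ - (s₁ + ((d : ℝ) + 1) / 2)/2) ?_ 
    (by linarith) ?_ m
  · rw [finrank_euclideanSpace_fin]; linarith
  · rwa [add_sub_cancel]
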